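/- Let b_1, b_2, …, b_k be positive integers with k ≥ 1, and let |b| = b_1 + b_2 + ⋯ + b_k. Then Υ_{w(b_k,…,b_2,b_1)} = Υ_{w(b_k,…,b_2)} · F(|b| − b_1, b_1), where for k = 1 the factor Υ_{w()} of the empty composition is interpreted as 1. -/

import Mathlib

/-- The simple transposition `sᵢ = (i, i+1)` acting on `ℕ` (positions are 1-indexed,
so a permutation of `{1,…,n}` is modeled as a permutation of `ℕ` fixing `0` and all `i > n`). -/
def sT (i : ℕ) : Equiv.Perm ℕ := Equiv.swap i (i + 1)

/-- The number of inversions `ℓ(w)` of `w` on `{1,…,n}`. -/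
def len (n : ℕ) (w : Equiv.Perm ℕ) : ℕ :=
  ((Finset.Icc 1 n ×ˢ Finset.Icc 1 n).filter
    (fun p => p.1 < p.2 ∧ w p.2 < w p.1)).card

open scoped Classical in
/-- Macdonald's identity form of the principal specialization `𝔖_w(1,…,1)` of the
Schubert polynomial: `Υ_w = (1/ℓ!) ⬝ Σ_{(a₁,…,a_ℓ) ∈ R(w)} a₁ a₂ ⋯ a_ℓ`, where the sum is
over reduced words of `w`, i.e. tuples with `1 ≤ aᵢ ≤ n − 1` and `w = s_{a₁} ⋯ s_{a_ℓ}`. -/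
noncomputable def Upsilon (n : ℕ) (w : Equiv.Perm ℕ) : ℚ :=
  ((len n w).factorial : ℚ)⁻¹ *
    ∑ a ∈ Finset.univ.filter (fun a : Fin (len n w) → Fin n =>
        (∀ i, 1 ≤ (a i : ℕ)) ∧ (List.ofFn fun i => sT ((a i : ℕ))).prod = w),
      ∏ i, ((a i : ℕ) : ℚ)

/-- Reversal of the block of positions `s+1, …, s+c`, as a permutation of `ℕ`. -/
def blockRev (s c : ℕ) : Equiv.Perm ℕ :=
  ((List.range (c / 2)).map fun i => Equiv.swap (s + i + 1) (s + c - i)).prod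

/-- The layered permutation `w(b_k, …, b_1)` whose blocks, read left to right,
are given by the list `b = [b_k, …, b_1]`: it reverses the consecutive blocks of
positions of sizes `b_k, b_{k−1}, …, b_1`. -/
def layeredPerm (b : List ℕ) : Equiv.Perm ℕ :=
  ((List.range b.length).map fun j => blockRev ((b.take j).sum) (b.getD j 0)).prod

/-- `F(m,p) = ∏_{1 ≤ i < j ≤ p} (2m + i + j − 1)/(i + j − 1)` (empty product is `1`). -/
noncomputable def F (m p : ℕ) : ℝ :=
  ∏ i ∈ Finset.Icc 1 p, ∏ j ∈ Finset.Ioc i p,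
    (2 * (m : ℝ) + i + j - 1) / ((i : ℝ) + j - 1)

/-! ### Inversions and reduced words -/

/-- Number of inversions of `w` among the positions in `s`. -/
def invCount (s : Finset ℕ) (w : Equiv.Perm ℕ) : ℕ :=
  ((s ×ˢ s).filter fun p => p.1 < p.2 ∧ w p.2 < w p.1).card

lemma sT_mul_self (i : ℕ) : sT i * sT i = 1 := Equiv.swap_mul_self _ _

lemma mul_sT_mul_sT (w : Equiv.Perm ℕ) (i : ℕ) : w * sT i * sT i = w := by
  rw [mul_assoc, sT_mul_self, mul_one]

lemma sT_left (i : ℕ) : sT i i = i + 1 := Equiv.swap_apply_left _ _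

lemma sT_right (i : ℕ) : sT i (i + 1) = i := Equiv.swap_apply_right _ _

lemma sT_of_ne {i x : ℕ} (h : x ≠ i) (h' : x ≠ i + 1) : sT i x = x :=
  Equiv.swap_apply_of_ne_of_ne h h'

lemma sT_sT (i x : ℕ) : sT i (sT i x) = x := Equiv.swap_apply_self _ _ _

lemma sT_mem {s : Finset ℕ} {i : ℕ} (hi : i ∈ s) (hi' : i + 1 ∈ s) (x : ℕ) :
    sT i x ∈ s ↔ x ∈ s := by
  by_cases h : x = i
  · subst h; simp [sT_left, hi, hi']
  by_cases h' : x = i + 1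
  · subst h'; simp [sT_right, hi, hi']
  rw [sT_of_ne h h']

lemma sT_lt_sT {i a b : ℕ} (hab : a < b) (h : ¬ (a = i ∧ b = i + 1)) : sT i a < sT i b := by
  simp only [sT, Equiv.swap_apply_def]
  split_ifs <;> omega

lemma invCount_mul_sT_of_lt {s : Finset ℕ} {w : Equiv.Perm ℕ} {i : ℕ} (hi : i ∈ s)
    (hi' : i + 1 ∈ s) (h : w i < w (i + 1)) :
    invCount s (w * sT i) = invCount s w + 1 := by
  have key : ((s ×ˢ s).filter fun p => p.1 < p.2 ∧ (w * sT i) p.2 < (w * sT i) p.1) =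
      insert (i, i + 1) (((s ×ˢ s).filter fun p => p.1 < p.2 ∧ w p.2 < w p.1).map
        (Equiv.prodCongr (sT i) (sT i)).toEmbedding) := by
    ext ⟨a, b⟩
    simp only [Finset.mem_insert, Finset.mem_map_equiv, Finset.mem_filter, Finset.mem_product]
    simp only [Equiv.Perm.mul_apply, Prod.mk.injEq, Equiv.prodCongr_symm, Equiv.prodCongr_apply, Prod.map]
    have hs : (sT i).symm = sT i := Equiv.symm_swap _ _
    rw [hs, sT_mem hi hi', sT_mem hi hi']
    by_cases hab : a = i ∧ b = i + 1
    · obtain ⟨rfl, rfl⟩ := hab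
      simp [sT_left, sT_right, hi, hi', h]
    · simp only [hab, false_or]
      refine and_congr_right fun _ => and_congr_left fun hw => ⟨fun h1 => sT_lt_sT h1 hab,
        fun h1 => ?_⟩
      have := sT_lt_sT (i := i) h1 ?_
      · simpa [sT_sT] using this
      · rintro ⟨h2, h3⟩
        rw [h2, h3] at hw
        omega
  unfold invCount
  rw [key, Finset.card_insert_of_notMem, Finset.card_map]
  simp only [Finset.mem_map_equiv, Finset.mem_filter, Equiv.prodCongr_symm,
    Equiv.prodCongr_apply, Prod.map]
  have hs : (sT i).symm = sT i := Equiv.symm_swap _ _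
  rw [hs, sT_left, sT_right]
  omega

lemma invCount_mul_sT_of_gt {s : Finset ℕ} {w : Equiv.Perm ℕ} {i : ℕ} (hi : i ∈ s)
    (hi' : i + 1 ∈ s) (h : w (i + 1) < w i) :
    invCount s w = invCount s (w * sT i) + 1 := by
  rw [← invCount_mul_sT_of_lt hi hi', mul_sT_mul_sT]
  simpa [sT_left, sT_right] using h

lemma invCount_one (s : Finset ℕ) : invCount s 1 = 0 := by
  unfold invCount
  rw [Finset.card_eq_zero, Finset.filter_eq_empty_iff]
  intro p _
  simp only [Equiv.Perm.one_apply]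
  omega

/-- `w` fixes every point outside `s`. -/
def FixesOff (s : Finset ℕ) (w : Equiv.Perm ℕ) : Prop := ∀ x, x ∉ s → w x = x

lemma FixesOff.mem {s : Finset ℕ} {w : Equiv.Perm ℕ} (hw : FixesOff s w) {x : ℕ} (hx : x ∈ s) :
    w x ∈ s := by
  by_contra h
  rw [w.injective (hw _ h)] at h
  exact h hx

lemma FixesOff.mul_sT {s : Finset ℕ} {w : Equiv.Perm ℕ} (hw : FixesOff s w) {i : ℕ} (hi : i ∈ s)
    (hi' : i + 1 ∈ s) : FixesOff s (w * sT i) := by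
  intro x hx
  rw [Equiv.Perm.mul_apply, sT_of_ne, hw x hx]
  · rintro rfl; exact hx hi
  · rintro rfl; exact hx hi'

lemma eq_one_of_invCount_eq_zero {a b : ℕ} {w : Equiv.Perm ℕ}
    (hw : FixesOff (Finset.Ioc a b) w) (h : invCount (Finset.Ioc a b) w = 0) : w = 1 := by
  have hmono : StrictMono w := by
    intro x y hxy
    by_cases hx : x ∈ Finset.Ioc a b <;> by_cases hy : y ∈ Finset.Ioc a b
    · unfold invCount at h
      rw [Finset.card_eq_zero, Finset.filter_eq_empty_iff] at h
      have := @h (x, y) (by simp only [Finset.mem_product]; exact ⟨hx, hy⟩)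
      have hne := w.injective.ne hxy.ne
      simp only at this
      omega
    · have := hw.mem hx
      rw [hw y hy]
      simp only [Finset.mem_Ioc] at *
      omega
    · have := hw.mem hy
      rw [hw x hx]
      simp only [Finset.mem_Ioc] at *
      omega
    · rwa [hw x hx, hw y hy]
  have hmono' : StrictMono w.symm := fun x y hxy => by
    rw [← hmono.lt_iff_lt]; simpa using hxy
  ext x
  refine le_antisymm ?_ hmono.le_apply
  have := hmono'.le_apply (x := w x)
  simpa using this

open scoped Classical in
/-- Weighted sum over all words of length `r` in the letters `1, …, n - 1` with product `w`. -/
noncomputable def wordSum (n : ℕ) (w : Equiv.Perm ℕ) (r : ℕ) : ℚ :=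
  ∑ a ∈ Finset.univ.filter (fun a : Fin r → Fin n =>
      (∀ i, 1 ≤ (a i : ℕ)) ∧ (List.ofFn fun i => sT ((a i : ℕ))).prod = w),
    ∏ i, ((a i : ℕ) : ℚ)

lemma upsilon_eq (n : ℕ) (w : Equiv.Perm ℕ) :
    Upsilon n w = ((invCount (Finset.Ioc 0 n) w).factorial : ℚ)⁻¹ *
      wordSum n w (invCount (Finset.Ioc 0 n) w) := rfl

lemma wordSum_zero_one (n : ℕ) : wordSum n 1 0 = 1 := by
  classical
  simp [wordSum]

lemma wordSum_succ (n : ℕ) (w : Equiv.Perm ℕ) (r : ℕ) :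
    wordSum n w (r + 1) = ∑ i ∈ Finset.Ico 1 n, (i : ℚ) * wordSum n (w * sT i) r := by
  classical
  have h1 : ∀ f : ℕ → ℚ, ∑ i ∈ Finset.Ico 1 n, f i =
      ∑ i : Fin n, if 1 ≤ (i : ℕ) then f i else 0 := by
    intro f
    rw [Fin.sum_univ_eq_sum_range (fun i => if 1 ≤ i then f i else 0) n, ← Finset.sum_filter]
    congr 1
    ext x
    simp only [Finset.mem_Ico, Finset.mem_filter, Finset.mem_range]
    omega
  rw [h1]
  unfold wordSum
  simp_rw [Finset.sum_filter, Finset.mul_sum]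
  rw [← (Fin.snocEquiv (fun _ : Fin (r + 1) => Fin n)).sum_comp, Fintype.sum_prod_type]
  refine Finset.sum_congr rfl fun i _ => ?_
  split_ifs with hi
  · refine Finset.sum_congr rfl fun a _ => ?_
    have hprod : (List.ofFn fun j => sT
        ((Fin.snocEquiv (fun _ : Fin (r + 1) => Fin n) (i, a) j : Fin n) : ℕ)).prod =
        (List.ofFn fun j => sT ((a j : ℕ))).prod * sT i := by
      rw [List.ofFn_succ', List.concat_eq_append, List.prod_append]
      simp [Fin.snocEquiv]
    have hall : (∀ j, 1 ≤ ((Fin.snocEquiv (fun _ : Fin (r + 1) => Fin n) (i, a) j : Fin n) : ℕ)) ↔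
        ∀ j, 1 ≤ (a j : ℕ) := by
      rw [Fin.forall_fin_succ']
      simp [Fin.snocEquiv, hi]
    have heq : (List.ofFn fun j => sT ((a j : ℕ))).prod * sT i = w ↔
        (List.ofFn fun j => sT ((a j : ℕ))).prod = w * sT i := by
      constructor
      · rintro rfl; rw [mul_sT_mul_sT]
      · intro h; rw [h, mul_sT_mul_sT]
    rw [mul_ite, mul_zero]
    refine if_congr (and_congr hall (by rw [hprod, heq])) ?_ rfl
    rw [Fin.prod_univ_castSucc]
    simp [Fin.snocEquiv, mul_comm]
  · refine Finset.sum_eq_zero fun a _ => if_neg ?_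
    rintro ⟨h, -⟩
    have := h (Fin.last r)
    simp [Fin.snocEquiv] at this
    omega

lemma wordSum_eq_zero {n r : ℕ} {w : Equiv.Perm ℕ} (h : r < invCount (Finset.Ioc 0 n) w) :
    wordSum n w r = 0 := by
  induction r generalizing w with
  | zero =>
    classical
    unfold wordSum
    refine Finset.sum_eq_zero fun a ha => ?_
    have : w = 1 := by simpa using (Finset.mem_filter.1 ha).2.2.symm
    rw [this, invCount_one] at h
    omega
  | succ r ih =>
    rw [wordSum_succ]
    refine Finset.sum_eq_zero fun i hi => ?_
    rw [Finset.mem_Ico] at hi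
    have h1 : i ∈ Finset.Ioc 0 n := by rw [Finset.mem_Ioc]; omega
    have h2 : i + 1 ∈ Finset.Ioc 0 n := by rw [Finset.mem_Ioc]; omega
    rw [ih, mul_zero]
    rcases lt_or_gt_of_ne (w.injective.ne (Nat.ne_of_lt (Nat.lt_succ_self i))) with hw | hw
    · rw [invCount_mul_sT_of_lt h1 h2 hw]; omega
    · rw [invCount_mul_sT_of_gt h1 h2 hw] at h; omega

lemma upsilon_one (n : ℕ) : Upsilon n 1 = 1 := by
  rw [upsilon_eq, invCount_one, wordSum_zero_one]; simp

/-- Removing the last letter of a reduced word. -/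
lemma upsilon_rec (n : ℕ) (w : Equiv.Perm ℕ) (hw : FixesOff (Finset.Ioc 0 n) w) :
    (invCount (Finset.Ioc 0 n) w : ℚ) * Upsilon n w =
      ∑ i ∈ Finset.Ico 1 n, if w (i + 1) < w i then (i : ℚ) * Upsilon n (w * sT i) else 0 := by
  rcases h : invCount (Finset.Ioc 0 n) w with _ | r
  · rw [eq_one_of_invCount_eq_zero hw h]
    simp
  · have hr : ((r + 1 : ℕ) : ℚ) * Upsilon n w = (r.factorial : ℚ)⁻¹ * wordSum n w (r + 1) := by
      rw [upsilon_eq, h, Nat.factorial_succ]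
      have := Nat.factorial_pos r
      push_cast
      field_simp
    rw [hr, wordSum_succ, Finset.mul_sum]
    refine Finset.sum_congr rfl fun i hi => ?_
    rw [Finset.mem_Ico] at hi
    have h1 : i ∈ Finset.Ioc 0 n := by rw [Finset.mem_Ioc]; omega
    have h2 : i + 1 ∈ Finset.Ioc 0 n := by rw [Finset.mem_Ioc]; omega
    split_ifs with hd
    · have h3 := invCount_mul_sT_of_gt h1 h2 hd
      have h4 : invCount (Finset.Ioc 0 n) (w * sT i) = r := by omega
      rw [upsilon_eq, h4]
      ring
    · have hd' : w i < w (i + 1) :=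
        lt_of_le_of_ne (not_lt.1 hd) (w.injective.ne (Nat.ne_of_lt (Nat.lt_succ_self i)))
      rw [wordSum_eq_zero, mul_zero, mul_zero]
      rw [invCount_mul_sT_of_lt h1 h2 hd']
      omega

/-! ### Divided differences -/

open MvPolynomial in
/-- Exchange the variables `Xᵢ` and `Xᵢ₊₁`. -/
noncomputable def swapVars (i : ℕ) : MvPolynomial ℕ ℚ →ₐ[ℚ] MvPolynomial ℕ ℚ := rename (sT i)

section DividedDifference

open MvPolynomial

lemma swapVars_X (i k : ℕ) : swapVars i (X k) = X (sT i k) := rename_X _ _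

lemma swapVars_swapVars (i : ℕ) (f : MvPolynomial ℕ ℚ) : swapVars i (swapVars i f) = f := by
  rw [swapVars, rename_rename]
  have : (sT i : ℕ → ℕ) ∘ sT i = id := funext fun x => sT_sT i x
  rw [this, rename_id_apply]

lemma swapVars_comm {i j : ℕ} (h : i + 1 < j) (f : MvPolynomial ℕ ℚ) :
    swapVars i (swapVars j f) = swapVars j (swapVars i f) := by
  simp only [swapVars, rename_rename]
  congr 2
  funext x
  simp only [Function.comp_apply, sT, Equiv.swap_apply_def]
  split_ifs <;> omega

lemma swapVars_braid (i : ℕ) (f : MvPolynomial ℕ ℚ) :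
    swapVars i (swapVars (i + 1) (swapVars i f)) =
      swapVars (i + 1) (swapVars i (swapVars (i + 1) f)) := by
  simp only [swapVars, rename_rename]
  congr 2
  funext x
  simp only [Function.comp_apply, sT, Equiv.swap_apply_def]
  split_ifs <;> omega

lemma X_sub_X_ne_zero {i j : ℕ} (h : i ≠ j) : (X i - X j : MvPolynomial ℕ ℚ) ≠ 0 :=
  sub_ne_zero.2 fun h' => h (X_injective h')

lemma X_sub_X_succ_ne_zero (i : ℕ) : (X i - X (i + 1) : MvPolynomial ℕ ℚ) ≠ 0 :=
  X_sub_X_ne_zero (by omega)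

lemma X_sub_X_dvd (i : ℕ) (f : MvPolynomial ℕ ℚ) :
    (X i - X (i + 1) : MvPolynomial ℕ ℚ) ∣ f - swapVars i f := by
  rw [← Ideal.mem_span_singleton, ← Ideal.Quotient.eq]
  set I := Ideal.span {(X i - X (i + 1) : MvPolynomial ℕ ℚ)}
  have hI : (X i - X (i + 1) : MvPolynomial ℕ ℚ) ∈ I := Ideal.subset_span rfl
  have : Ideal.Quotient.mkₐ ℚ I = (Ideal.Quotient.mkₐ ℚ I).comp (swapVars i) := by
    refine algHom_ext fun k => ?_
    rw [AlgHom.comp_apply, swapVars_X]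
    refine Ideal.Quotient.eq.2 ?_
    by_cases h : k = i
    · subst h; rwa [sT_left]
    by_cases h' : k = i + 1
    · subst h'; rw [sT_right]; simpa using I.neg_mem hI
    · rw [sT_of_ne h h']; simp
  exact DFunLike.congr_fun this f

/-- The divided difference operator `f ↦ (f - sᵢ f) / (Xᵢ - Xᵢ₊₁)`. -/
noncomputable def divDiff (i : ℕ) (f : MvPolynomial ℕ ℚ) : MvPolynomial ℕ ℚ :=
  (X_sub_X_dvd i f).choose

lemma divDiff_spec (i : ℕ) (f : MvPolynomial ℕ ℚ) :
    (X i - X (i + 1)) * divDiff i f = f - swapVars i f :=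
  (X_sub_X_dvd i f).choose_spec.symm

lemma divDiff_eq {i : ℕ} {f g : MvPolynomial ℕ ℚ}
    (h : (X i - X (i + 1)) * g = f - swapVars i f) : divDiff i f = g :=
  mul_left_cancel₀ (X_sub_X_succ_ne_zero i)
    ((divDiff_spec i f).trans h.symm)

lemma swapVars_divDiff (i : ℕ) (f : MvPolynomial ℕ ℚ) :
    swapVars i (divDiff i f) = divDiff i f := by
  refine (divDiff_eq ?_).symm
  have := congrArg (swapVars i) (divDiff_spec i f)
  simp only [map_mul, map_sub, swapVars_X, swapVars_swapVars, sT_left, sT_right] at this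
  linear_combination -this

lemma divDiff_divDiff (i : ℕ) (f : MvPolynomial ℕ ℚ) : divDiff i (divDiff i f) = 0 :=
  divDiff_eq (by rw [swapVars_divDiff, sub_self, mul_zero])

lemma divDiff_comm {i j : ℕ} (h : i + 1 < j) (f : MvPolynomial ℕ ℚ) :
    divDiff i (divDiff j f) = divDiff j (divDiff i f) := by
  refine mul_left_cancel₀ (mul_ne_zero (X_sub_X_succ_ne_zero i)
    (X_sub_X_succ_ne_zero j)) ?_
  have h1 := divDiff_spec i (divDiff j f)
  have h2 := divDiff_spec j (divDiff i f)
  have h3 := divDiff_spec i f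
  have h4 := divDiff_spec j f
  have h5 := congrArg (swapVars i) h4
  have h6 := congrArg (swapVars j) h3
  have e1 : sT i j = j := sT_of_ne (by omega) (by omega)
  have e2 : sT i (j + 1) = j + 1 := sT_of_ne (by omega) (by omega)
  have e3 : sT j i = i := sT_of_ne (by omega) (by omega)
  have e4 : sT j (i + 1) = i + 1 := sT_of_ne (by omega) (by omega)
  simp only [map_mul, map_sub, swapVars_X, e1, e2, e3, e4] at h5 h6
  rw [swapVars_comm h] at h5
  linear_combination (X j - X (j + 1)) * h1 - (X i - X (i + 1)) * h2 + h4 - h3 - h5 + h6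

lemma divDiff_triple {S : Type*} [CommRing S] (s t : S →+* S) {a b f u v w : S}
    (ha : s a = -a) (hb : s b = a + b) (hta : t a = a + b)
    (hsu : s u = u) (hu : a * u = f - s f) (hv : b * v = u - t u) (hw : a * w = v - s v) :
    a * b * (a + b) * w = f - s f - t f + t (s f) + s (t f) - s (t (s f)) := by
  have h1 := congrArg s hv
  have h2 := congrArg t hu
  have h3 := congrArg s h2
  simp only [map_mul, map_sub, map_add, hb, hta, hsu, ha] at h1 h2 h3
  linear_combination b * (a + b) * hw + (a + b) * hv - b * h1 + hu - h2 + h3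

lemma divDiff_braid (i : ℕ) (f : MvPolynomial ℕ ℚ) :
    divDiff i (divDiff (i + 1) (divDiff i f)) =
      divDiff (i + 1) (divDiff i (divDiff (i + 1) f)) := by
  have e1 : sT i (i + 1 + 1) = i + 1 + 1 := sT_of_ne (by omega) (by omega)
  have e2 : sT (i + 1) i = i := sT_of_ne (by omega) (by omega)
  have h1 := divDiff_triple (swapVars i).toRingHom (swapVars (i + 1)).toRingHom
    (a := X i - X (i + 1)) (b := X (i + 1) - X (i + 1 + 1)) (f := f)
    (by simp [swapVars_X, sT_left, sT_right]) (by simp [swapVars_X, sT_right, e1])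
    (by simp [swapVars_X, sT_left, e2]) (swapVars_divDiff i f) (divDiff_spec i f)
    (divDiff_spec (i + 1) _) (divDiff_spec i _)
  have h2 := divDiff_triple (swapVars (i + 1)).toRingHom (swapVars i).toRingHom
    (a := X (i + 1) - X (i + 1 + 1)) (b := X i - X (i + 1)) (f := f)
    (by simp [swapVars_X, sT_left, sT_right]) (by simp [swapVars_X, sT_left, e2])
    (by simp [swapVars_X, sT_right, e1]) (swapVars_divDiff (i + 1) f) (divDiff_spec (i + 1) f)
    (divDiff_spec i _) (divDiff_spec (i + 1) _)
  have h3 := swapVars_braid i f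
  simp only [AlgHom.toRingHom_eq_coe, RingHom.coe_coe] at h1 h2
  refine mul_left_cancel₀ (mul_ne_zero (mul_ne_zero
    (X_sub_X_succ_ne_zero i)
    (X_sub_X_succ_ne_zero (i + 1)))
    (X_sub_X_ne_zero (i := i) (j := i + 1 + 1) (by omega))) ?_
  linear_combination h1 - h2 - h3

lemma degreeOf_swapVars (i k : ℕ) (f : MvPolynomial ℕ ℚ) :
    degreeOf k (swapVars i f) = degreeOf (sT i k) f := by
  have := degreeOf_rename_of_injective (p := f) (sT i).injective (sT i k)
  rwa [sT_sT] at this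

lemma degreeOf_divDiff_le (i k : ℕ) (f : MvPolynomial ℕ ℚ) :
    degreeOf k (divDiff i f) ≤ max (degreeOf k f) (degreeOf (sT i k) f) := by
  by_cases h0 : divDiff i f = 0
  · simp [h0]
  have h1 := degreeOf_mul_eq (n := k) (X_sub_X_succ_ne_zero i) h0
  rw [divDiff_spec] at h1
  have h2 := degreeOf_sub_le k f (swapVars i f)
  rw [degreeOf_swapVars] at h2
  omega

lemma degreeOf_divDiff_lt {i k : ℕ} (hk : k = i ∨ k = i + 1) (f : MvPolynomial ℕ ℚ)
    (h0 : divDiff i f ≠ 0) :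
    degreeOf k (divDiff i f) + 1 ≤ max (degreeOf k f) (degreeOf (sT i k) f) := by
  have h1 := degreeOf_mul_eq (n := k) (X_sub_X_succ_ne_zero i) h0
  rw [divDiff_spec] at h1
  have h2 := degreeOf_sub_le k f (swapVars i f)
  rw [degreeOf_swapVars] at h2
  have h3 : 1 ≤ degreeOf k (X i - X (i + 1) : MvPolynomial ℕ ℚ) := by
    have hc : Finsupp.single k 1 ∈ (X i - X (i + 1) : MvPolynomial ℕ ℚ).support := by
      rw [mem_support_iff]
      rcases hk with rfl | rfl <;> simp [coeff_X, Finsupp.single_left_inj]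
    simpa using monomial_le_degreeOf k hc
  omega

end DividedDifference

/-! ### Schubert polynomials in the variables `1 + Xⱼ`, `m < j ≤ n` -/

section Schubert

open MvPolynomial

/-- The Euler operator `∑ xⱼ ∂/∂xⱼ` for `xⱼ = 1 + Xⱼ`, `m < j ≤ n`. -/
noncomputable def euler (m n : ℕ) :
    Derivation ℚ (MvPolynomial ℕ ℚ) (MvPolynomial ℕ ℚ) :=
  ∑ j ∈ Finset.Ioc m n, (1 + X j : MvPolynomial ℕ ℚ) • pderiv j

lemma euler_apply (m n : ℕ) (f : MvPolynomial ℕ ℚ) :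
    euler m n f = ∑ j ∈ Finset.Ioc m n, (1 + X j) * pderiv j f := by
  have h := congrFun (map_sum (Derivation.coeFnAddMonoidHom (R := ℚ) (A := MvPolynomial ℕ ℚ)
    (M := MvPolynomial ℕ ℚ)) (fun j => (1 + X j : MvPolynomial ℕ ℚ) • pderiv j)
    (Finset.Ioc m n)) f
  rw [Finset.sum_apply] at h
  exact h

lemma euler_X (m n k : ℕ) :
    euler m n (X k) = if k ∈ Finset.Ioc m n then 1 + X k else 0 := by
  rw [euler_apply]
  simp [pderiv_X, Pi.single_apply]

lemma euler_X_of_mem {m n k : ℕ} (hk : k ∈ Finset.Ioc m n) : euler m n (X k) = 1 + X k := by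
  rw [euler_X, if_pos hk]

lemma euler_swapVars {m n i : ℕ} (hi : i ∈ Finset.Ioc m n) (hi' : i + 1 ∈ Finset.Ioc m n)
    (f : MvPolynomial ℕ ℚ) : euler m n (swapVars i f) = swapVars i (euler m n f) := by
  induction f using MvPolynomial.induction_on with
  | C a => simp [← algebraMap_eq]
  | add p q hp hq => simp [hp, hq]
  | mul_X p k hp =>
    simp only [map_mul, Derivation.leibniz, hp, swapVars_X, euler_X, sT_mem hi hi', map_add,
      smul_eq_mul]
    split_ifs <;> simp [swapVars_X]

lemma euler_divDiff {m n i : ℕ} (hi : i ∈ Finset.Ioc m n) (hi' : i + 1 ∈ Finset.Ioc m n)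
    {f : MvPolynomial ℕ ℚ} {d : ℚ} (hf : euler m n f = C (d + 1) * f) :
    euler m n (divDiff i f) = C d * divDiff i f := by
  have h := congrArg (euler m n) (divDiff_spec i f)
  rw [map_sub, euler_swapVars hi hi', hf, Derivation.leibniz, map_sub, euler_X_of_mem hi,
    euler_X_of_mem hi', map_mul, algHom_C] at h
  have h' := divDiff_spec i f
  refine mul_left_cancel₀ (X_sub_X_succ_ne_zero i) ?_
  simp only [smul_eq_mul, algebraMap_eq, map_add, map_one] at h
  linear_combination h - (C d + 1) * h'

lemma euler_mul {m n : ℕ} {f g : MvPolynomial ℕ ℚ} {a b : ℚ} (hf : euler m n f = C a * f)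
    (hg : euler m n g = C b * g) : euler m n (f * g) = C (a + b) * (f * g) := by
  rw [Derivation.leibniz, hf, hg, map_add]
  simp only [smul_eq_mul]
  ring

lemma euler_prod {ι : Type*} {m n : ℕ} (s : Finset ι) {f : ι → MvPolynomial ℕ ℚ} {a : ι → ℚ}
    (hf : ∀ i ∈ s, euler m n (f i) = C (a i) * f i) :
    euler m n (∏ i ∈ s, f i) = C (∑ i ∈ s, a i) * ∏ i ∈ s, f i := by
  classical
  induction s using Finset.induction_on with
  | empty => simp
  | insert i s hi ih =>
    rw [Finset.prod_insert hi, Finset.sum_insert hi]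
    exact euler_mul (hf i (Finset.mem_insert_self _ _))
      (ih fun j hj => hf j (Finset.mem_insert_of_mem hj))

/-- The monomial `∏ xⱼ ^ e j` in the variables `xⱼ = 1 + Xⱼ`, `m < j ≤ n`. -/
noncomputable def shiftedMonomial (m n : ℕ) (e : ℕ → ℕ) : MvPolynomial ℕ ℚ :=
  ∏ j ∈ Finset.Ioc m n, (1 + X j) ^ e j

lemma euler_shiftedMonomial (m n : ℕ) (e : ℕ → ℕ) :
    euler m n (shiftedMonomial m n e) =
      C (∑ j ∈ Finset.Ioc m n, (e j : ℚ)) * shiftedMonomial m n e := by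
  refine euler_prod _ fun j hj => ?_
  rw [Derivation.leibniz_pow, map_add, euler_X_of_mem hj, Derivation.map_one_eq_zero]
  rcases e j with _ | k
  · simp
  · simp only [Nat.add_sub_cancel, smul_eq_mul, nsmul_eq_mul, zero_add, map_natCast]
    ring

lemma swapVars_shiftedMonomial {m n i : ℕ} (hi : i ∈ Finset.Ioc m n)
    (hi' : i + 1 ∈ Finset.Ioc m n) {e : ℕ → ℕ} (he : e i = e (i + 1)) :
    swapVars i (shiftedMonomial m n e) = shiftedMonomial m n e := by
  unfold shiftedMonomial
  rw [map_prod]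
  refine Finset.prod_equiv (sT i) (fun j => (sT_mem hi hi' j).symm) fun j _ => ?_
  have : e (sT i j) = e j := by
    by_cases h : j = i
    · subst h; rw [sT_left, he]
    by_cases h' : j = i + 1
    · subst h'; rw [sT_right, he]
    rw [sT_of_ne h h']
  simp [swapVars_X, this]

lemma degreeOf_shiftedMonomial_le {m n j : ℕ} (hj : j ∈ Finset.Ioc m n) (e : ℕ → ℕ) :
    degreeOf j (shiftedMonomial m n e) ≤ e j := by
  refine (degreeOf_prod_le _ _ _).trans ?_
  rw [← Finset.sum_erase_add _ _ hj]
  have h1 : ∀ k ∈ (Finset.Ioc m n).erase j,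
      degreeOf j ((1 + X k : MvPolynomial ℕ ℚ) ^ e k) = 0 := by
    intro k hk
    refine Nat.eq_zero_of_le_zero ((degreeOf_pow_le _ _ _).trans ?_)
    have : degreeOf j (1 + X k : MvPolynomial ℕ ℚ) ≤ 0 :=
      (degreeOf_add_le _ _ _).trans (by simp [degreeOf_X_of_ne (Finset.ne_of_mem_erase hk).symm])
    rw [Nat.le_zero.1 this, mul_zero]
  rw [Finset.sum_eq_zero h1, zero_add]
  refine (degreeOf_pow_le _ _ _).trans ?_
  have : degreeOf j (1 + X j : MvPolynomial ℕ ℚ) ≤ 1 :=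
    (degreeOf_add_le _ _ _).trans (by simp)
  simpa using Nat.mul_le_mul_left (e j) this

/-- Number of pairs `a < b` with `a`, `b` in `(m, n]`. -/
def pairCount (m n : ℕ) : ℕ :=
  ((Finset.Ioc m n ×ˢ Finset.Ioc m n).filter fun p => p.1 < p.2).card

lemma pairCount_eq_sum (m n : ℕ) : pairCount m n = ∑ j ∈ Finset.Ioc m n, (n - j) := by
  unfold pairCount
  rw [Finset.card_filter, Finset.sum_product]
  refine Finset.sum_congr rfl fun j hj => ?_
  rw [← Finset.card_filter, ← Nat.card_Ioc]
  congr 1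
  ext k
  simp only [Finset.mem_filter, Finset.mem_Ioc] at *
  omega

lemma invCount_le_pairCount (m n : ℕ) (w : Equiv.Perm ℕ) :
    invCount (Finset.Ioc m n) w ≤ pairCount m n :=
  Finset.card_le_card (Finset.monotone_filter_right _ fun _ _ h => h.1)

open scoped Classical in
/-- Auxiliary recursion for `schubert`, on the number of noninversions of `w`. -/
noncomputable def schubertAux (m n : ℕ) : ℕ → Equiv.Perm ℕ → MvPolynomial ℕ ℚ
  | 0, _ => shiftedMonomial m n fun j => n - j
  | k + 1, w =>
    if h : ∃ i, m < i ∧ i < n ∧ w i < w (i + 1) then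
      divDiff h.choose (schubertAux m n k (w * sT h.choose))
    else 0

/-- Schubert polynomial of a permutation of `(m, n]` in the variables `1 + Xⱼ`. -/
noncomputable def schubert (m n : ℕ) (w : Equiv.Perm ℕ) : MvPolynomial ℕ ℚ :=
  schubertAux m n (pairCount m n - invCount (Finset.Ioc m n) w) w

lemma mem_Ioc_left {m n i : ℕ} (h : m < i) (h' : i < n) : i ∈ Finset.Ioc m n :=
  Finset.mem_Ioc.2 ⟨h, h'.le⟩

lemma mem_Ioc_right {m n i : ℕ} (h : m < i) (h' : i < n) : i + 1 ∈ Finset.Ioc m n :=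
  Finset.mem_Ioc.2 ⟨by omega, h'⟩

lemma colength_eq {m n i : ℕ} {w : Equiv.Perm ℕ} (h : m < i) (h' : i < n)
    (hw : w i < w (i + 1)) :
    pairCount m n - invCount (Finset.Ioc m n) w =
      pairCount m n - invCount (Finset.Ioc m n) (w * sT i) + 1 := by
  have h1 := invCount_mul_sT_of_lt (mem_Ioc_left h h') (mem_Ioc_right h h') hw
  have h2 := invCount_le_pairCount m n (w * sT i)
  omega

lemma schubert_cases (m n : ℕ) (w : Equiv.Perm ℕ) :
    (invCount (Finset.Ioc m n) w = pairCount m n ∧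
      schubert m n w = shiftedMonomial m n fun j => n - j) ∨
    (schubert m n w = 0 ∧ ∀ i, m < i → i < n → ¬ w i < w (i + 1)) ∨
    ∃ i, m < i ∧ i < n ∧ w i < w (i + 1) ∧
      schubert m n w = divDiff i (schubert m n (w * sT i)) := by
  have h2 := invCount_le_pairCount m n w
  rcases hk : pairCount m n - invCount (Finset.Ioc m n) w with _ | k
  · left
    refine ⟨by omega, ?_⟩
    rw [schubert, hk, schubertAux]
  · right
    by_cases h : ∃ i, m < i ∧ i < n ∧ w i < w (i + 1)
    · right
      obtain ⟨h3, h4, h5⟩ := h.choose_spec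
      refine ⟨h.choose, h3, h4, h5, ?_⟩
      have := colength_eq h3 h4 h5
      rw [schubert, hk, schubertAux, dif_pos h, schubert]
      congr 2
      omega
    · left
      refine ⟨by rw [schubert, hk, schubertAux, dif_neg h], ?_⟩
      push Not at h
      intro i h3 h4
      exact not_lt.2 (h i h3 h4)

lemma sT_braid (i : ℕ) : sT i * sT (i + 1) * sT i = sT (i + 1) * sT i * sT (i + 1) := by
  ext x
  simp only [Equiv.Perm.mul_apply, sT, Equiv.swap_apply_def]
  split_ifs <;> omega

lemma sT_comm {i j : ℕ} (h : i + 1 < j) : sT i * sT j = sT j * sT i := by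
  ext x
  simp only [Equiv.Perm.mul_apply, sT, Equiv.swap_apply_def]
  split_ifs <;> omega

lemma schubert_of_lt {m n : ℕ} {w : Equiv.Perm ℕ} {i : ℕ} (hi : m < i) (hi' : i < n)
    (hw : w i < w (i + 1)) : schubert m n w = divDiff i (schubert m n (w * sT i)) := by
  induction hk : pairCount m n - invCount (Finset.Ioc m n) w using Nat.strong_induction_on
    generalizing w i with
  | _ k ih =>
  subst hk
  have step : ∀ {v : Equiv.Perm ℕ} {j : ℕ}, pairCount m n - invCount (Finset.Ioc m n) v <
      pairCount m n - invCount (Finset.Ioc m n) w → m < j → j < n → v j < v (j + 1) →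
      schubert m n v = divDiff j (schubert m n (v * sT j)) :=
    fun hv hj hj' hlt => ih _ hv hj hj' hlt rfl
  have diamond : ∀ i j, m < i → i < j → j < n → w i < w (i + 1) → w j < w (j + 1) →
      divDiff i (schubert m n (w * sT i)) = divDiff j (schubert m n (w * sT j)) := by
    intro i j hi hij hj hwi hwj
    have ci := colength_eq hi (hij.trans hj) hwi
    have cj := colength_eq (hi.trans hij) hj hwj
    rcases Nat.lt_or_ge (i + 1) j with hlt | hge
    · have e1 : sT i j = j := sT_of_ne (by omega) (by omega)
      have e2 : sT i (j + 1) = j + 1 := sT_of_ne (by omega) (by omega)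
      have e3 : sT j i = i := sT_of_ne (by omega) (by omega)
      have e4 : sT j (i + 1) = i + 1 := sT_of_ne (by omega) (by omega)
      rw [step (v := w * sT i) (j := j) (by omega) (by omega) hj (by simpa [e1, e2] using hwj),
        step (v := w * sT j) (j := i) (by omega) hi (by omega) (by simpa [e3, e4] using hwi),
        mul_assoc, mul_assoc, sT_comm hlt, divDiff_comm hlt]
    · obtain rfl : j = i + 1 := by omega
      have e1 : sT i (i + 1 + 1) = i + 1 + 1 := sT_of_ne (by omega) (by omega)
      have e2 : sT (i + 1) i = i := sT_of_ne (by omega) (by omega)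
      have a1 : (w * sT i) (i + 1) < (w * sT i) (i + 1 + 1) := by
        simp only [Equiv.Perm.mul_apply, e1, sT_right]; omega
      have a2 : (w * sT i * sT (i + 1)) i < (w * sT i * sT (i + 1)) (i + 1) := by
        simp only [Equiv.Perm.mul_apply, e1, e2, sT_left]; omega
      have b1 : (w * sT (i + 1)) i < (w * sT (i + 1)) (i + 1) := by
        simp only [Equiv.Perm.mul_apply, e2, sT_left]; omega
      have b2 : (w * sT (i + 1) * sT i) (i + 1) < (w * sT (i + 1) * sT i) (i + 1 + 1) := by
        simp only [Equiv.Perm.mul_apply, e1, e2, sT_right]; omega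
      have ca := colength_eq (m := m) (n := n) (by omega) hj a1
      have cb := colength_eq (m := m) (n := n) hi (by omega) b1
      rw [step (by omega) (by omega) hj a1, step (by omega) hi (by omega) a2,
        step (by omega) hi (by omega) b1, step (by omega) (by omega) hj b2, divDiff_braid]
      congr 4
      simp only [mul_assoc]
      congr 1
      simpa only [mul_assoc] using sT_braid i
  rcases schubert_cases m n w with ⟨h, -⟩ | ⟨-, h⟩ | ⟨j, hj, hj', hwj, h⟩
  · have := colength_eq hi hi' hw
    omega
  · exact absurd hw (h i hi hi')
  · rw [h]
    rcases lt_trichotomy i j with hij | rfl | hij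
    · exact (diamond i j hi hij hj' hw hwj).symm
    · rfl
    · exact diamond j i hj hij hi' hwj hw

lemma divDiff_schubert_of_lt {m n i : ℕ} {w : Equiv.Perm ℕ} (hi : m < i) (hi' : i < n)
    (hw : w i < w (i + 1)) : divDiff i (schubert m n w) = 0 := by
  rw [schubert_of_lt hi hi' hw, divDiff_divDiff]

lemma divDiff_schubert_of_gt {m n i : ℕ} {w : Equiv.Perm ℕ} (hi : m < i) (hi' : i < n)
    (hw : w (i + 1) < w i) : divDiff i (schubert m n w) = schubert m n (w * sT i) := by
  rw [schubert_of_lt (w := w * sT i) hi hi' (by simpa [sT_left, sT_right] using hw),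
    mul_sT_mul_sT]

lemma euler_schubert (m n : ℕ) (w : Equiv.Perm ℕ) :
    euler m n (schubert m n w) =
      C (invCount (Finset.Ioc m n) w : ℚ) * schubert m n w := by
  induction hk : pairCount m n - invCount (Finset.Ioc m n) w using Nat.strong_induction_on
    generalizing w with
  | _ k ih =>
  rcases schubert_cases m n w with ⟨h, h'⟩ | ⟨h, -⟩ | ⟨i, hi, hi', hw, h⟩
  · rw [h', euler_shiftedMonomial, h, pairCount_eq_sum, Nat.cast_sum]
  · simp [h]
  · rw [h]
    refine euler_divDiff (mem_Ioc_left hi hi') (mem_Ioc_right hi hi') ?_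
    have := colength_eq hi hi' hw
    rw [ih _ (by omega) (w * sT i) rfl,
      invCount_mul_sT_of_lt (mem_Ioc_left hi hi') (mem_Ioc_right hi hi') hw]
    push_cast
    rfl

lemma degreeOf_schubert_le {m n : ℕ} (w : Equiv.Perm ℕ) {j : ℕ} (hj : j ∈ Finset.Ioc m n) :
    degreeOf j (schubert m n w) ≤ n - j := by
  induction hk : pairCount m n - invCount (Finset.Ioc m n) w using Nat.strong_induction_on
    generalizing w j with
  | _ k ih =>
  rcases schubert_cases m n w with ⟨-, h⟩ | ⟨h, -⟩ | ⟨i, hi, hi', hw, h⟩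
  · rw [h]
    exact degreeOf_shiftedMonomial_le hj _
  · simp [h]
  · have hc := colength_eq hi hi' hw
    have ih' := fun {l : ℕ} (hl : l ∈ Finset.Ioc m n) => ih _ (by omega) (w * sT i) hl rfl
    rw [h]
    by_cases h0 : divDiff i (schubert m n (w * sT i)) = 0
    · simp [h0]
    have h1 := ih' (mem_Ioc_left hi hi')
    have h2 := ih' (mem_Ioc_right hi hi')
    by_cases hj1 : j = i
    · have := degreeOf_divDiff_lt (k := j) (Or.inl hj1) _ h0
      subst hj1
      rw [sT_left] at this
      omega
    by_cases hj2 : j = i + 1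
    · have := degreeOf_divDiff_lt (k := j) (Or.inr hj2) _ h0
      subst hj2
      rw [sT_right] at this
      omega
    · have := degreeOf_divDiff_le i j (schubert m n (w * sT i))
      rw [sT_of_ne hj1 hj2, max_self] at this
      exact this.trans (ih' hj)

lemma schubert_longest {m n : ℕ} {w : Equiv.Perm ℕ} (hw : StrictAntiOn w (Finset.Ioc m n)) :
    schubert m n w = shiftedMonomial m n fun j => n - j := by
  have : invCount (Finset.Ioc m n) w = pairCount m n := by
    unfold invCount pairCount
    congr 1
    refine Finset.filter_congr fun p hp => ?_
    rw [Finset.mem_product] at hp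
    exact ⟨fun h => h.1, fun h => ⟨h, hw hp.1 hp.2 h⟩⟩
  rw [schubert, this, Nat.sub_self, schubertAux]

/-- `w` is decreasing on `(m, b]`, except that the value at `r` exceeds only those to its right. -/
structure SweepStage (m n b r : ℕ) (w : Equiv.Perm ℕ) : Prop where
  fixesOff : FixesOff (Finset.Ioc m n) w
  anti : ∀ x y, m < x → x < y → y ≤ b → x ≠ r → y ≠ r → w y < w x
  anti_at : ∀ y, r < y → y ≤ b → w y < w r
  schubert_eq : schubert m n w =
    shiftedMonomial m n fun j => b - j - if j < r then 1 else 0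

lemma SweepStage.step {m n b r : ℕ} {w : Equiv.Perm ℕ} (h : SweepStage m n b r w)
    (hr : m < r) (hrb : r < b) (hbn : b ≤ n) : SweepStage m n b (r + 1) (w * sT r) := by
  have hr1 := mem_Ioc_left hr (hrb.trans_le hbn)
  have hr2 := mem_Ioc_right hr (hrb.trans_le hbn)
  refine ⟨h.fixesOff.mul_sT hr1 hr2, ?_, ?_, ?_⟩
  · intro x y hx hxy hy hx' hy'
    simp only [Equiv.Perm.mul_apply]
    by_cases h1 : x = r
    · rw [h1, sT_left, sT_of_ne (by omega) hy']
      exact h.anti _ _ (by omega) (by omega) hy (by omega) (by omega)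
    rw [sT_of_ne h1 hx']
    by_cases h2 : y = r
    · rw [h2, sT_left]
      exact h.anti _ _ hx (by omega) (by omega) h1 (by omega)
    rw [sT_of_ne h2 hy']
    exact h.anti _ _ hx hxy hy h1 h2
  · intro y hy hyb
    simp only [Equiv.Perm.mul_apply]
    rw [sT_right, sT_of_ne (by omega) (by omega)]
    exact h.anti_at y (by omega) hyb
  · rw [← divDiff_schubert_of_gt hr (by omega) (h.anti_at (r + 1) (by omega) hrb)]
    set G := shiftedMonomial m n fun j => b - j - if j < r + 1 then 1 else 0 with hG
    have h1 : schubert m n w = (1 + X r) * G := by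
      rw [h.schubert_eq, hG]
      unfold shiftedMonomial
      rw [← Finset.mul_prod_erase _ (fun j => (1 + X j : MvPolynomial ℕ ℚ) ^ _) hr1,
        ← Finset.mul_prod_erase _ (fun j => (1 + X j : MvPolynomial ℕ ℚ) ^ _) hr1, ← mul_assoc,
        ← pow_succ']
      have h0 : b - r - (if r < r then 1 else 0) = b - r - (if r < r + 1 then 1 else 0) + 1 := by
        simp only [lt_irrefl, if_false, Nat.lt_succ_self, if_true]
        omega
      rw [h0]
      congr 1
      refine Finset.prod_congr rfl fun j hj => ?_
      have := Finset.ne_of_mem_erase hj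
      congr 1
      split_ifs <;> omega
    have h2 : swapVars r G = G :=
      swapVars_shiftedMonomial hr1 hr2 (by
        simp only [Nat.lt_succ_self, if_true, lt_irrefl, if_false]; omega)
    refine divDiff_eq ?_
    rw [h1, map_mul, h2, map_add, map_one, swapVars_X, sT_left]
    ring

lemma SweepStage.next {m n b : ℕ} {w : Equiv.Perm ℕ} (h : SweepStage m n (b + 1) (b + 1) w) :
    SweepStage m n b (m + 1) w := by
  refine ⟨h.fixesOff, fun x y hx hxy hy _ _ => h.anti x y hx hxy (by omega) (by omega) (by omega),
    fun y hy hyb => h.anti _ _ (by omega) hy (by omega) (by omega) (by omega), ?_⟩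
  rw [h.schubert_eq]
  refine Finset.prod_congr rfl fun j hj => ?_
  rw [Finset.mem_Ioc] at hj
  congr 1
  dsimp only
  split_ifs <;> omega

lemma exists_sweepStage {m n : ℕ} {w₀ : Equiv.Perm ℕ} (hfix : FixesOff (Finset.Ioc m n) w₀)
    (hanti : StrictAntiOn w₀ (Finset.Ioc m n)) (hmn : m ≤ n) (k : ℕ) (hk : k ≤ n - m) :
    ∃ w, SweepStage m n (n - k) (m + 1) w := by
  induction k with
  | zero =>
    refine ⟨w₀, hfix, fun x y hx hxy hy _ _ => hanti ?_ ?_ hxy, fun y hy hyn => hanti ?_ ?_ hy, ?_⟩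
    any_goals simp only [Finset.coe_Ioc, Set.mem_Ioc]; omega
    rw [schubert_longest hanti]
    refine Finset.prod_congr rfl fun j hj => ?_
    rw [Finset.mem_Ioc] at hj
    congr 1
    dsimp only
    split_ifs <;> omega
  | succ k ih =>
    obtain ⟨w, hw⟩ := ih (by omega)
    have sweep : ∀ t, m + 1 + t ≤ n - k → ∃ w, SweepStage m n (n - k) (m + 1 + t) w := by
      intro t
      induction t with
      | zero => exact fun _ => ⟨w, hw⟩
      | succ t iht =>
        intro ht
        obtain ⟨v, hv⟩ := iht (by omega)
        exact ⟨_, hv.step (by omega) (by omega) (by omega)⟩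
    obtain ⟨v, hv⟩ := sweep (n - k - (m + 1)) (by omega)
    have e : n - k = n - (k + 1) + 1 := by omega
    have e' : m + 1 + (n - k - (m + 1)) = n - (k + 1) + 1 := by omega
    rw [e', e] at hv
    exact ⟨v, hv.next⟩

lemma schubert_one {m n : ℕ} {w₀ : Equiv.Perm ℕ} (hfix : FixesOff (Finset.Ioc m n) w₀)
    (hanti : StrictAntiOn w₀ (Finset.Ioc m n)) (hmn : m ≤ n) : schubert m n 1 = 1 := by
  obtain ⟨w, hw⟩ := exists_sweepStage hfix hanti hmn (n - m) le_rfl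
  have h1 : schubert m n w = 1 := by
    rw [hw.schubert_eq]
    refine Finset.prod_eq_one fun j hj => ?_
    rw [Finset.mem_Ioc] at hj
    have : n - (n - m) - j - (if j < m + 1 then 1 else 0) = 0 := by omega
    dsimp only
    rw [this, pow_zero]
  have h2 := euler_schubert m n w
  rw [h1, mul_one, Derivation.map_one_eq_zero] at h2
  have h3 : invCount (Finset.Ioc m n) w = 0 := by
    have := C_injective ℕ ℚ (h2.symm.trans (map_zero C).symm)
    exact_mod_cast this
  rw [eq_one_of_invCount_eq_zero hw.fixesOff h3] at h1
  exact h1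

end Schubert

/-! ### The functional evaluating Schubert polynomials -/

section Pairing

open MvPolynomial

@[to_additive]
lemma prod_Ioc_add (m p : ℕ) {M : Type*} [CommMonoid M] (f : ℕ → M) :
    ∏ j ∈ Finset.Ioc m (m + p), f j = ∏ i : Fin p, f (m + 1 + i) := by
  rw [Fin.prod_univ_eq_prod_range fun i => f (m + 1 + i)]
  have h := Finset.prod_Ico_eq_prod_range f (m + 1) (m + p + 1)
  rw [show m + p + 1 - (m + 1) = p by omega] at h
  rw [← h]
  congr 1
  ext j
  simp only [Finset.mem_Ioc, Finset.mem_Ico]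
  omega

/-- The Vandermonde determinant in the variables `X j`, `m < j ≤ m + p`. -/
noncomputable def vandermondeDet (m p : ℕ) : MvPolynomial ℕ ℚ :=
  (Matrix.vandermonde fun k : Fin p => (X (m + 1 + k) : MvPolynomial ℕ ℚ)).det

lemma swapVars_vandermondeDet {m p i : ℕ} (hi : m < i) (hi' : i < m + p) :
    swapVars i (vandermondeDet m p) = -vandermondeDet m p := by
  unfold vandermondeDet
  have hne : (⟨i - m - 1, by omega⟩ : Fin p) ≠ ⟨i - m, by omega⟩ := by
    rw [Ne, Fin.mk.injEq]; omega
  rw [← neg_one_mul, AlgHom.map_det]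
  have h := Matrix.det_permute (Equiv.swap (⟨i - m - 1, by omega⟩ : Fin p) ⟨i - m, by omega⟩)
    (Matrix.vandermonde fun k : Fin p => (X (m + 1 + k) : MvPolynomial ℕ ℚ))
  rw [Equiv.Perm.sign_swap hne] at h
  simp only [Units.val_neg, Units.val_one, Int.cast_neg, Int.cast_one] at h
  rw [← h]
  congr 1
  ext1 a b
  simp only [AlgHom.mapMatrix_apply, Matrix.map_apply, Matrix.vandermonde_apply, map_pow,
    swapVars_X, Matrix.submatrix_apply, id]
  congr 2
  rw [Equiv.swap_apply_def, sT, Equiv.swap_apply_def]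
  simp only [Fin.ext_iff]
  split_ifs <;> (try dsimp only) <;> omega

lemma euler_vandermondeDet (m p : ℕ) :
    euler m (m + p) (vandermondeDet m p) =
      C (∑ i : Fin p, ((p - 1 - i : ℕ) : ℚ)) * vandermondeDet m p := by
  rw [vandermondeDet, Matrix.det_vandermonde]
  refine euler_prod _ fun i _ => ?_
  have : ((p - 1 - i : ℕ) : ℚ) = ∑ _j ∈ Finset.Ioi i, (1 : ℚ) := by simp
  rw [this]
  refine euler_prod _ fun j _ => ?_
  rw [map_sub, euler_X_of_mem, euler_X_of_mem, map_one]
  · ring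
  all_goals rw [Finset.mem_Ioc]; omega

lemma degreeOf_vandermondeDet_lt (m p j : ℕ) (hp : 0 < p) :
    degreeOf j (vandermondeDet m p) < p := by
  rw [vandermondeDet, Matrix.det_apply]
  refine (degreeOf_sum_le _ _ _).trans_lt ((Finset.sup_lt_iff hp).2 fun σ _ => ?_)
  have h : ∀ i : Fin p, degreeOf j (Matrix.vandermonde
      (fun k : Fin p => (X (m + 1 + k) : MvPolynomial ℕ ℚ)) (σ i) i) ≤
        if j = m + 1 + σ i then (i : ℕ) else 0 := by
    intro i
    rw [Matrix.vandermonde_apply]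
    refine (degreeOf_pow_le _ _ _).trans ?_
    rw [degreeOf_X]
    split_ifs <;> simp
  have h' : ∑ i, (if j = m + 1 + σ i then (i : ℕ) else 0) < p := by
    by_cases h0 : ∃ i, j = m + 1 + (σ i : ℕ)
    · obtain ⟨i, hi⟩ := h0
      rw [Finset.sum_eq_single_of_mem i (Finset.mem_univ _), if_pos hi]
      · exact i.2
      · intro k _ hk
        refine if_neg fun hk' => hk (σ.injective (Fin.ext ?_))
        omega
    · rw [Finset.sum_eq_zero fun i _ => if_neg fun hi => h0 ⟨i, hi⟩]
      exact hp
  have h'' := ((degreeOf_prod_le _ _ _).trans (Finset.sum_le_sum fun i _ => h i)).trans_lt h'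
  rcases Int.units_eq_one_or (Equiv.Perm.sign σ) with hσ | hσ
  · rwa [hσ, one_smul]
  · rwa [hσ, Units.neg_smul, one_smul, degreeOf_neg]

/-- The exponent vector with `j - 1` at each `m < j ≤ m + p`. -/
noncomputable def targetExp (m p : ℕ) : ℕ →₀ ℕ :=
  Finsupp.indicator (Finset.Ioc m (m + p)) fun j _ => j - 1

lemma targetExp_of_mem {m p j : ℕ} (hj : j ∈ Finset.Ioc m (m + p)) :
    targetExp m p j = j - 1 := Finsupp.indicator_of_mem hj _

lemma targetExp_of_notMem {m p j : ℕ} (hj : j ∉ Finset.Ioc m (m + p)) :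
    targetExp m p j = 0 := Finsupp.indicator_of_notMem hj _

lemma sum_targetExp (m p : ℕ) :
    ∑ j ∈ Finset.Ioc m (m + p), (targetExp m p j : ℚ) =
      ∑ i : Fin p, ((p - 1 - i : ℕ) : ℚ) + ∑ _j ∈ Finset.Ioc m (m + p), (m : ℚ) := by
  rw [sum_Ioc_add, sum_Ioc_add, ← Finset.sum_add_distrib, ← Equiv.sum_comp Fin.revPerm]
  refine Finset.sum_congr rfl fun i _ => ?_
  rw [targetExp_of_mem (by rw [Finset.mem_Ioc]; omega)]
  rw [← Nat.cast_add]
  congr 1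
  simp only [Fin.revPerm_apply, Fin.val_rev]
  omega

/-- The antisymmetric weight against which polynomials are paired. -/
noncomputable def weight (m p : ℕ) : MvPolynomial ℕ ℚ :=
  vandermondeDet m p * shiftedMonomial m (m + p) fun _ => m

lemma swapVars_weight {m p i : ℕ} (hi : m < i) (hi' : i < m + p) :
    swapVars i (weight m p) = -weight m p := by
  rw [weight, map_mul, swapVars_vandermondeDet hi hi',
    swapVars_shiftedMonomial (mem_Ioc_left hi hi') (mem_Ioc_right hi hi') rfl, neg_mul]

lemma euler_weight (m p : ℕ) :
    euler m (m + p) (weight m p) =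
      C (∑ j ∈ Finset.Ioc m (m + p), (targetExp m p j : ℚ)) * weight m p := by
  rw [sum_targetExp]
  exact euler_mul (euler_vandermondeDet m p) (euler_shiftedMonomial _ _ _)

lemma degreeOf_weight_lt {m p : ℕ} (hp : 0 < p) :
    degreeOf (m + p) (weight m p) < m + p := by
  have h1 := degreeOf_vandermondeDet_lt m p (m + p) hp
  have h2 : degreeOf (m + p) (shiftedMonomial m (m + p) fun _ => m) ≤ m :=
    degreeOf_shiftedMonomial_le (by rw [Finset.mem_Ioc]; omega) _
  have h3 := degreeOf_mul_le (m + p) (vandermondeDet m p) (shiftedMonomial m (m + p) fun _ => m)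
  rw [weight]
  omega

/-- The linear functional taking `f` to a coefficient of `f * weight`. -/
noncomputable def pairing (m p : ℕ) (f : MvPolynomial ℕ ℚ) : ℚ :=
  coeff (targetExp m p) (f * weight m p)

lemma coeff_swapVars (i : ℕ) (d : ℕ →₀ ℕ) (f : MvPolynomial ℕ ℚ) :
    coeff d (swapVars i f) = coeff (d.mapDomain (sT i)) f := by
  have := coeff_rename_mapDomain (sT i) (sT i).injective (swapVars i f) d
  rw [← this]
  exact congrArg _ (swapVars_swapVars i f)

lemma pairing_divDiff {m p i : ℕ} (hi : m < i) (hi' : i < m + p) (f : MvPolynomial ℕ ℚ) :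
    pairing m p (divDiff i f) =
      coeff (targetExp m p + Finsupp.single i 1) (f * weight m p) := by
  set D := divDiff i (weight m p) with hD
  have h1 := divDiff_spec i (weight m p)
  rw [swapVars_weight hi hi', ← hD] at h1
  have h2 : divDiff i f * weight m p + divDiff i f * weight m p = f * D - swapVars i (f * D) := by
    refine mul_left_cancel₀ (X_sub_X_succ_ne_zero i) ?_
    rw [map_mul, hD, swapVars_divDiff, ← hD]
    linear_combination 2 * weight m p * divDiff_spec i f - (f - swapVars i f) * h1
  have h3 : f * weight m p + f * weight m p = f * D * X i - f * D * X (i + 1) := by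
    linear_combination -f * h1
  have h4 : targetExp m p + Finsupp.single i 1 =
      (targetExp m p).mapDomain (sT i) + Finsupp.single (i + 1) 1 := by
    ext j
    have hs : (sT i).symm = sT i := Equiv.symm_swap _ _
    have e1 := targetExp_of_mem (mem_Ioc_left hi hi')
    have e2 := targetExp_of_mem (mem_Ioc_right hi hi')
    rw [Finsupp.add_apply, Finsupp.add_apply, Finsupp.mapDomain_equiv_apply, hs]
    by_cases hj1 : j = i
    · subst hj1
      rw [sT_left, e1, e2, Finsupp.single_eq_same, Finsupp.single_eq_of_ne (by omega)]
      omega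
    by_cases hj2 : j = i + 1
    · subst hj2
      rw [sT_right, e1, e2, Finsupp.single_eq_same, Finsupp.single_eq_of_ne (by omega)]
      omega
    · rw [sT_of_ne hj1 hj2, Finsupp.single_eq_of_ne (by omega), Finsupp.single_eq_of_ne (by omega)]
  have h5 := congrArg (coeff (targetExp m p)) h2
  have h6 := congrArg (coeff (targetExp m p + Finsupp.single i 1)) h3
  rw [coeff_sub, coeff_add, coeff_swapVars] at h5
  rw [coeff_sub, coeff_add, coeff_mul_X] at h6
  nth_rw 3 [h4] at h6
  rw [coeff_mul_X] at h6
  rw [pairing]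
  linarith

lemma coeff_one_add_X_mul_pderiv (d : ℕ →₀ ℕ) (j : ℕ) (f : MvPolynomial ℕ ℚ) :
    coeff d ((1 + X j) * pderiv j f) =
      (d j + 1) * coeff (d + Finsupp.single j 1) f + d j * coeff d f := by
  rw [add_mul, one_mul, coeff_add, coeff_pderiv, coeff_X_mul', coeff_pderiv]
  split_ifs with h
  · have h0 : 1 ≤ d j := Nat.one_le_iff_ne_zero.2 (Finsupp.mem_support_iff.1 h)
    rw [tsub_add_cancel_of_le (Finsupp.single_le_iff.2 h0), Finsupp.tsub_apply,
      Finsupp.single_eq_same, Nat.cast_sub h0]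
    ring
  · rw [Finsupp.notMem_support_iff.1 h]
    ring

lemma mul_pairing_of_euler {m p : ℕ} {f : MvPolynomial ℕ ℚ} {d : ℚ}
    (hf : euler m (m + p) f = C d * f) :
    d * pairing m p f = ∑ j ∈ Finset.Ioc m (m + p),
      (j : ℚ) * coeff (targetExp m p + Finsupp.single j 1) (f * weight m p) := by
  have h := congrArg (coeff (targetExp m p)) (euler_mul hf (euler_weight m p))
  rw [euler_apply, coeff_C_mul, coeff_sum] at h
  simp only [coeff_one_add_X_mul_pderiv] at h
  rw [Finset.sum_add_distrib, ← Finset.sum_mul, add_mul, add_left_inj] at h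
  rw [pairing, ← h]
  refine Finset.sum_congr rfl fun j hj => ?_
  rw [targetExp_of_mem hj]
  rw [Finset.mem_Ioc] at hj
  rw [← Nat.cast_add_one, Nat.sub_add_cancel (by omega)]

lemma mul_pairing_schubert (m p : ℕ) (v : Equiv.Perm ℕ) :
    (invCount (Finset.Ioc m (m + p)) v : ℚ) * pairing m p (schubert m (m + p) v) =
      ∑ i ∈ Finset.Ioo m (m + p),
        if v (i + 1) < v i then (i : ℚ) * pairing m p (schubert m (m + p) (v * sT i)) else 0 := by
  rw [mul_pairing_of_euler (euler_schubert m (m + p) v)]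
  rcases Nat.eq_zero_or_pos p with rfl | hp
  · simp
  rw [← Finset.Ioo_insert_right (by omega), Finset.sum_insert (by simp)]
  have hlast : coeff (targetExp m p + Finsupp.single (m + p) 1)
      (schubert m (m + p) v * weight m p) = 0 := by
    have hmem : m + p ∈ Finset.Ioc m (m + p) := by rw [Finset.mem_Ioc]; omega
    by_contra h
    have h1 := monomial_le_degreeOf (m + p) (mem_support_iff.2 h)
    have h2 := degreeOf_mul_le (m + p) (schubert m (m + p) v) (weight m p)
    have h3 := degreeOf_schubert_le v hmem
    have h4 := degreeOf_weight_lt (m := m) hp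
    rw [Finsupp.add_apply, Finsupp.single_eq_same, targetExp_of_mem hmem] at h1
    omega
  rw [hlast, mul_zero, zero_add]
  refine Finset.sum_congr rfl fun i hi => ?_
  rw [Finset.mem_Ioo] at hi
  rw [← pairing_divDiff hi.1 hi.2]
  split_ifs with hv
  · rw [divDiff_schubert_of_gt hi.1 hi.2 hv]
  · have hv' : v i < v (i + 1) :=
      lt_of_le_of_ne (not_lt.1 hv) fun h => by have := v.injective h; omega
    rw [divDiff_schubert_of_lt hi.1 hi.2 hv', pairing, zero_mul, coeff_zero, mul_zero]

end Pairing

/-! ### Products of permutations of complementary intervals -/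

section Product

variable {m p : ℕ} {u v : Equiv.Perm ℕ}

lemma mul_apply_of_le (hv : FixesOff (Finset.Ioc m (m + p)) v) {x : ℕ} (hx : x ≤ m) :
    (u * v) x = u x := by
  rw [Equiv.Perm.mul_apply, hv x (by rw [Finset.mem_Ioc]; omega)]

lemma mul_apply_of_gt (hu : FixesOff (Finset.Ioc 0 m) u)
    (hv : FixesOff (Finset.Ioc m (m + p)) v) {x : ℕ} (hx : m < x) : (u * v) x = v x := by
  rw [Equiv.Perm.mul_apply]
  refine hu _ ?_
  by_cases h : x ∈ Finset.Ioc m (m + p)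
  · have := hv.mem h
    rw [Finset.mem_Ioc] at *
    omega
  · rw [hv x h, Finset.mem_Ioc]
    omega

lemma FixesOff.mul_Ioc (hu : FixesOff (Finset.Ioc 0 m) u)
    (hv : FixesOff (Finset.Ioc m (m + p)) v) : FixesOff (Finset.Ioc 0 (m + p)) (u * v) := by
  intro x hx
  rw [Finset.mem_Ioc] at hx
  rcases le_or_gt x m with h | h
  · rw [mul_apply_of_le hv h]
    exact hu x (by rw [Finset.mem_Ioc]; omega)
  · rw [mul_apply_of_gt hu hv h]
    exact hv x (by rw [Finset.mem_Ioc]; omega)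

lemma apply_le_of_fixesOff (hu : FixesOff (Finset.Ioc 0 m) u) {x : ℕ} (hx : x ≤ m) : u x ≤ m := by
  by_cases h : x ∈ Finset.Ioc 0 m
  · exact (Finset.mem_Ioc.1 (hu.mem h)).2
  · rwa [hu x h]

lemma lt_apply_of_fixesOff (hv : FixesOff (Finset.Ioc m (m + p)) v) {x : ℕ} (hx : m < x) :
    m < v x := by
  by_cases h : x ∈ Finset.Ioc m (m + p)
  · exact (Finset.mem_Ioc.1 (hv.mem h)).1
  · rwa [hv x h]

lemma mul_sT_comm (hv : FixesOff (Finset.Ioc m (m + p)) v) {i : ℕ} (hi : i < m) :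
    v * sT i = sT i * v := by
  have hle : ∀ {x}, x ≤ m → v x = x := fun hx => hv _ (by rw [Finset.mem_Ioc]; omega)
  ext x
  rw [Equiv.Perm.mul_apply, Equiv.Perm.mul_apply]
  rcases le_or_gt x m with hx | hx
  · rw [hle hx, hle]
    rw [sT, Equiv.swap_apply_def]
    split_ifs <;> omega
  · have := lt_apply_of_fixesOff hv hx
    rw [sT_of_ne (by omega) (by omega), sT_of_ne (by omega) (by omega)]

lemma invCount_mul (hu : FixesOff (Finset.Ioc 0 m) u) (hv : FixesOff (Finset.Ioc m (m + p)) v) :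
    invCount (Finset.Ioc 0 (m + p)) (u * v) =
      invCount (Finset.Ioc 0 m) u + invCount (Finset.Ioc m (m + p)) v := by
  unfold invCount
  rw [← Finset.card_union_of_disjoint]
  · congr 1
    ext ⟨x, y⟩
    simp only [Finset.mem_union, Finset.mem_filter, Finset.mem_product, Finset.mem_Ioc]
    rcases le_or_gt x m with hx | hx <;> rcases le_or_gt y m with hy | hy
    · rw [mul_apply_of_le hv hx, mul_apply_of_le hv hy]
      omega
    · rw [mul_apply_of_le hv hx, mul_apply_of_gt hu hv hy]
      have := apply_le_of_fixesOff hu hx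
      have := lt_apply_of_fixesOff hv hy
      omega
    · omega
    · rw [mul_apply_of_gt hu hv hx, mul_apply_of_gt hu hv hy]
      omega
  · refine Finset.disjoint_left.2 fun q hq hq' => ?_
    simp only [Finset.mem_filter, Finset.mem_product, Finset.mem_Ioc] at hq hq'
    omega

lemma sum_Ico_one_add (m p : ℕ) (f : ℕ → ℚ) (hf : 1 ≤ m → f m = 0) :
    ∑ i ∈ Finset.Ico 1 (m + p), f i =
      ∑ i ∈ Finset.Ico 1 m, f i + ∑ i ∈ Finset.Ioo m (m + p), f i := by
  rcases Nat.eq_zero_or_pos m with rfl | hm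
  · simp only [Finset.Ico_eq_empty_of_le, zero_le, Finset.sum_empty, zero_add]
    rfl
  rw [← Finset.sum_Ico_consecutive f hm (Nat.le_add_right m p)]
  congr 1
  rcases Nat.eq_zero_or_pos p with rfl | hp
  · simp
  rw [← Finset.Ioo_insert_left (by omega), Finset.sum_insert (by simp), hf hm, zero_add]

lemma upsilon_mul (h1 : pairing m p (schubert m (m + p) 1) = 1)
    (hu : FixesOff (Finset.Ioc 0 m) u) (hv : FixesOff (Finset.Ioc m (m + p)) v) :
    Upsilon (m + p) (u * v) = Upsilon m u * pairing m p (schubert m (m + p) v) := by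
  induction hk : invCount (Finset.Ioc 0 (m + p)) (u * v) generalizing u v with
  | zero =>
    rw [invCount_mul hu hv] at hk
    rw [eq_one_of_invCount_eq_zero hu (by omega), eq_one_of_invCount_eq_zero hv (by omega), h1,
      mul_one, upsilon_one, upsilon_one, mul_one]
  | succ k ih =>
    have hrec := upsilon_rec (m + p) (u * v) (hu.mul_Ioc hv)
    rw [sum_Ico_one_add] at hrec
    swap
    · intro _
      rw [if_neg]
      rw [mul_apply_of_gt hu hv (Nat.lt_succ_self m), mul_apply_of_le hv le_rfl]
      have := apply_le_of_fixesOff hu (le_refl m)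
      have := lt_apply_of_fixesOff hv (Nat.lt_succ_self m)
      omega
    have e1 : ∀ i ∈ Finset.Ico 1 m,
        (if (u * v) (i + 1) < (u * v) i then (i : ℚ) * Upsilon (m + p) (u * v * sT i) else 0) =
          (if u (i + 1) < u i then (i : ℚ) * Upsilon m (u * sT i) else 0) *
            pairing m p (schubert m (m + p) v) := by
      intro i hi
      rw [Finset.mem_Ico] at hi
      have hi1 : i ∈ Finset.Ioc 0 m := Finset.mem_Ioc.2 (by omega)
      have hi2 : i + 1 ∈ Finset.Ioc 0 m := Finset.mem_Ioc.2 (by omega)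
      rw [mul_apply_of_le hv (by omega), mul_apply_of_le hv (by omega)]
      split_ifs with h
      · have hcomm : u * v * sT i = u * sT i * v := by
          rw [mul_assoc, mul_assoc]
          rw [mul_sT_comm hv (by omega)]
        have h3 := invCount_mul (hu.mul_sT hi1 hi2) hv
        have h4 := invCount_mul hu hv
        have h5 := invCount_mul_sT_of_gt hi1 hi2 h
        rw [hcomm, ih (hu.mul_sT hi1 hi2) hv (by omega), mul_assoc]
      · rw [zero_mul]
    have e2 : ∀ i ∈ Finset.Ioo m (m + p),
        (if (u * v) (i + 1) < (u * v) i then (i : ℚ) * Upsilon (m + p) (u * v * sT i) else 0) =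
          Upsilon m u * (if v (i + 1) < v i then
            (i : ℚ) * pairing m p (schubert m (m + p) (v * sT i)) else 0) := by
      intro i hi
      rw [Finset.mem_Ioo] at hi
      have hi1 := mem_Ioc_left hi.1 hi.2
      have hi2 := mem_Ioc_right hi.1 hi.2
      rw [mul_apply_of_gt hu hv (by omega), mul_apply_of_gt hu hv (by omega)]
      split_ifs with h
      · have h3 := invCount_mul hu (hv.mul_sT hi1 hi2)
        have h4 := invCount_mul hu hv
        have h5 := invCount_mul_sT_of_gt hi1 hi2 h
        rw [mul_assoc, ih hu (hv.mul_sT hi1 hi2) (by omega)]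
        ring
      · rw [mul_zero]
    rw [Finset.sum_congr rfl e1, Finset.sum_congr rfl e2, ← Finset.sum_mul, ← Finset.mul_sum,
      ← upsilon_rec m u hu, ← mul_pairing_schubert, hk] at hrec
    have hk' := invCount_mul hu hv
    rw [hk] at hk'
    have hk'' : ((k + 1 : ℕ) : ℚ) = invCount (Finset.Ioc 0 m) u +
        invCount (Finset.Ioc m (m + p)) v := by rw [hk']; push_cast; rfl
    refine mul_left_cancel₀ (Nat.cast_ne_zero.2 (Nat.succ_ne_zero k) : ((k + 1 : ℕ) : ℚ) ≠ 0) ?_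
    rw [hrec, hk'']
    ring

end Product

/-! ### The functional on shifted monomials -/

section Determinant

open MvPolynomial

lemma degreeOf_aeval_X {j k : ℕ} (h : j ≠ k) (g : Polynomial ℚ) :
    degreeOf j (Polynomial.aeval (X k : MvPolynomial ℕ ℚ) g) = 0 := by
  induction g using Polynomial.induction_on' with
  | add g g' hg hg' =>
    rw [map_add]
    exact Nat.eq_zero_of_le_zero ((degreeOf_add_le _ _ _).trans (by rw [hg, hg', max_self]))
  | monomial n c =>
    rw [Polynomial.aeval_monomial, algebraMap_eq]
    refine Nat.eq_zero_of_le_zero ((degreeOf_mul_le _ _ _).trans ?_)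
    have := degreeOf_pow_le j (X k : MvPolynomial ℕ ℚ) n
    rw [degreeOf_X_of_ne h] at this
    rw [degreeOf_C]
    omega

lemma coeff_aeval_X_mul {j : ℕ} {f : MvPolynomial ℕ ℚ} (hf : degreeOf j f = 0)
    (g : Polynomial ℚ) (d : ℕ →₀ ℕ) :
    coeff d (Polynomial.aeval (X j) g * f) = g.coeff (d j) * coeff (d.erase j) f := by
  induction g using Polynomial.induction_on' with
  | add g h hg hh => rw [map_add, add_mul, coeff_add, hg, hh, Polynomial.coeff_add, add_mul]
  | monomial k c =>
    rw [Polynomial.aeval_monomial, X_pow_eq_monomial, algebraMap_eq, C_mul_monomial, mul_one,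
      coeff_monomial_mul', Polynomial.coeff_monomial]
    by_cases hk : k = d j
    · rw [if_pos hk, if_pos (by rw [Finsupp.single_le_iff]; exact hk.le)]
      congr 2
      ext x
      by_cases hx : x = j
      · subst hx; simp [hk]
      · rw [Finsupp.tsub_apply, Finsupp.single_eq_of_ne hx, Finsupp.erase_ne hx, Nat.sub_zero]
    · rw [if_neg hk, zero_mul]
      split_ifs with h
      · rw [Finsupp.single_le_iff] at h
        have : coeff (d - Finsupp.single j k) f = 0 := by
          by_contra h0
          have := monomial_le_degreeOf j (mem_support_iff.2 h0)
          rw [hf, Finsupp.tsub_apply, Finsupp.single_eq_same] at this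
          omega
        rw [this, mul_zero]
      · rfl

lemma coeff_prod_aeval_X {ι : Type*} {φ : ι → ℕ} (hφ : Function.Injective φ) (s : Finset ι)
    (g : ι → Polynomial ℚ) (d : ℕ →₀ ℕ) (hd : ∀ x, d x ≠ 0 → ∃ i ∈ s, φ i = x) :
    coeff d (∏ i ∈ s, Polynomial.aeval (X (φ i) : MvPolynomial ℕ ℚ) (g i)) =
      ∏ i ∈ s, (g i).coeff (d (φ i)) := by
  classical
  induction s using Finset.induction_on generalizing d with
  | empty =>
    have : d = 0 := by
      ext x
      by_contra h
      simpa using hd x h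
    simp [this]
  | insert i s hi ih =>
    have hne : ∀ k ∈ s, φ i ≠ φ k := fun k hk h => hi (hφ h ▸ hk)
    rw [Finset.prod_insert hi, Finset.prod_insert hi, coeff_aeval_X_mul, ih]
    · congr 1
      refine Finset.prod_congr rfl fun k hk => ?_
      rw [Finsupp.erase_ne (hne k hk).symm]
    · intro x hx
      by_cases hxi : x = φ i
      · simp [hxi] at hx
      · rw [Finsupp.erase_ne hxi] at hx
        obtain ⟨k, hk, hk'⟩ := hd x hx
        rcases Finset.mem_insert.1 hk with rfl | hk
        · exact absurd hk'.symm hxi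
        · exact ⟨k, hk, hk'⟩
    · refine Nat.eq_zero_of_le_zero ((degreeOf_prod_le _ _ _).trans ?_)
      rw [Finset.sum_eq_zero fun k hk => degreeOf_aeval_X (hne k hk) _]

lemma pairing_shiftedMonomial (m p : ℕ) (e : ℕ → ℕ) :
    pairing m p (shiftedMonomial m (m + p) e) =
      (Matrix.of fun i k : Fin p =>
        if (k : ℕ) ≤ m + i then ((e (m + 1 + i) + m).choose (m + i - k) : ℚ) else 0).det := by
  have h1 : shiftedMonomial m (m + p) e * weight m p =
      ∑ σ : Equiv.Perm (Fin p), Equiv.Perm.sign σ • ∏ i : Fin p,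
        Polynomial.aeval (X (m + 1 + i) : MvPolynomial ℕ ℚ) (Polynomial.X ^ (σ i : ℕ) *
          (1 + Polynomial.X : Polynomial ℚ) ^ (e (m + 1 + i) + m)) := by
    have h2 : shiftedMonomial m (m + p) e * weight m p = vandermondeDet m p *
        ∏ i : Fin p, (1 + X (m + 1 + i)) ^ (e (m + 1 + i) + m) := by
      rw [weight, mul_left_comm]
      unfold shiftedMonomial
      rw [← Finset.prod_mul_distrib, prod_Ioc_add]
      simp only [pow_add]
    rw [h2, vandermondeDet, ← Matrix.det_transpose, Matrix.det_apply, Finset.sum_mul]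
    refine Finset.sum_congr rfl fun σ _ => ?_
    rw [smul_mul_assoc, ← Finset.prod_mul_distrib]
    simp [Matrix.vandermonde_apply]
  rw [pairing, h1, ← Matrix.det_transpose, Matrix.det_apply, coeff_sum]
  refine Finset.sum_congr rfl fun σ _ => ?_
  have h3 : ∀ (ε : ℤˣ) (f : MvPolynomial ℕ ℚ) d, coeff d (ε • f) = ε • coeff d f := by
    intro ε f d
    rcases Int.units_eq_one_or ε with rfl | rfl
    · rw [one_smul, one_smul]
    · rw [Units.neg_smul, Units.neg_smul, one_smul, one_smul, coeff_neg]
  rw [h3, coeff_prod_aeval_X (φ := fun i : Fin p => m + 1 + i)]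
  · congr 1
    refine Finset.prod_congr rfl fun i _ => ?_
    rw [targetExp_of_mem (by rw [Finset.mem_Ioc]; omega), Polynomial.coeff_X_pow_mul',
      Polynomial.coeff_one_add_X_pow, Matrix.transpose_apply, Matrix.of_apply,
      show m + 1 + (i : ℕ) - 1 = m + i by omega]
  · intro i k h
    exact Fin.ext (Nat.add_left_cancel h)
  · intro x hx
    by_cases h : x ∈ Finset.Ioc m (m + p)
    · rw [Finset.mem_Ioc] at h
      exact ⟨⟨x - (m + 1), by omega⟩, Finset.mem_univ _, by dsimp only; omega⟩
    · exact absurd (targetExp_of_notMem h) hx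

lemma pairing_one (m p : ℕ) : pairing m p 1 = 1 := by
  have h := pairing_shiftedMonomial m p 0
  have h1 : shiftedMonomial m (m + p) 0 = 1 := by simp [shiftedMonomial]
  rw [h1] at h
  rw [h, Matrix.det_of_isUpperTriangular]
  · refine Finset.prod_eq_one fun i _ => ?_
    simp
  · intro i k hik
    have hik' : (k : ℕ) < i := hik
    rw [Matrix.of_apply, if_pos (by omega), Nat.choose_eq_zero_of_lt, Nat.cast_zero]
    rw [Pi.zero_apply]
    omega

end Determinant

/-! ### Evaluation of the determinant -/

section Evaluation

open Polynomial

/-- Polynomials whose value at `i`, up to normalization, is `(m + i).choose (2 * i - k)`. -/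
noncomputable def rowPoly (m p k : ℕ) : ℚ[X] :=
  (∏ l ∈ Finset.range k, (C 2 * X - C (l : ℚ))) *
    ∏ r ∈ Finset.Ico (k + 1) p, (C ((m + r : ℕ) : ℚ) - X)

lemma rowPoly_succ_add (m p k : ℕ) (hk : k < p) :
    rowPoly m (p + 1) (k + 1) + C 2 * rowPoly m (p + 1) k =
      C ((2 * m + k + 2 : ℕ) : ℚ) * rowPoly (m + 1) p k := by
  have h1 : ∏ r ∈ Finset.Ico (k + 1) p, (C ((m + 1 + r : ℕ) : ℚ) - X) =
      ∏ r ∈ Finset.Ico (k + 1 + 1) (p + 1), (C ((m + r : ℕ) : ℚ) - X) := by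
    rw [← Finset.prod_Ico_add' (fun r => C ((m + r : ℕ) : ℚ) - X) (k + 1) p 1]
    refine Finset.prod_congr rfl fun r _ => ?_
    rw [show m + 1 + r = m + (r + 1) by omega]
  unfold rowPoly
  rw [h1, Finset.prod_eq_prod_Ico_succ_bot (by omega : k + 1 < p + 1), Finset.prod_range_succ]
  simp only [Nat.cast_add, Nat.cast_mul, map_add, map_mul, Nat.cast_one, map_one, Nat.cast_ofNat]
  have : (C 2 : ℚ[X]) = 2 := rfl
  rw [this]
  ring

lemma natDegree_rowPoly_lt (m : ℕ) {p k : ℕ} (hk : k < p) : (rowPoly m p k).natDegree < p := by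
  have h1 : (∏ l ∈ Finset.range k, (C 2 * X - C (l : ℚ))).natDegree ≤ k := by
    refine (natDegree_prod_le _ _).trans ?_
    refine (Finset.sum_le_card_nsmul _ _ 1 fun l _ => ?_).trans (by simp)
    compute_degree
  have h2 : (∏ r ∈ Finset.Ico (k + 1) p, (C ((m + r : ℕ) : ℚ) - X)).natDegree ≤ p - (k + 1) := by
    refine (natDegree_prod_le _ _).trans ?_
    refine (Finset.sum_le_card_nsmul _ _ 1 fun l _ => ?_).trans (by simp)
    compute_degree
  have h3 := natDegree_mul_le (p := ∏ l ∈ Finset.range k, (C 2 * X - C (l : ℚ)))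
    (q := ∏ r ∈ Finset.Ico (k + 1) p, (C ((m + r : ℕ) : ℚ) - X))
  rw [rowPoly]
  omega

lemma coeff_rowPoly_zero (m p : ℕ) : (rowPoly m (p + 1) 0).coeff p = (-1) ^ p := by
  have h : ∀ s : Finset ℕ, (∏ r ∈ s, (C ((m + r : ℕ) : ℚ) - X)).coeff s.card = (-1) ^ s.card := by
    intro s
    have := coeff_prod_of_natDegree_le (s := s) (fun r => C ((m + r : ℕ) : ℚ) - X) 1
      fun r _ => by compute_degree
    rw [mul_one] at this
    rw [this]
    refine (Finset.prod_congr rfl fun r _ => ?_).trans (Finset.prod_const _)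
    rw [coeff_sub, coeff_C_succ, coeff_X_one, zero_sub]
  have := h (Finset.Ico (0 + 1) (p + 1))
  rw [Nat.card_Ico, show p + 1 - (0 + 1) = p by omega] at this
  rw [rowPoly, Finset.prod_range_zero, one_mul, this]

/-- The value of the coefficient determinant of the polynomials `rowPoly`. -/
def coeffDet (m p : ℕ) : ℕ :=
  ∏ t ∈ Finset.range p, ∏ s ∈ Finset.range t, (2 * m + s + t + 1)

lemma coeffDet_succ (m p : ℕ) :
    coeffDet m (p + 1) = (∏ k : Fin p, (2 * m + k + 2)) * coeffDet (m + 1) p := by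
  rw [Fin.prod_univ_eq_prod_range fun k => 2 * m + k + 2]
  unfold coeffDet
  rw [Finset.prod_range_succ', Finset.prod_range_zero, mul_one, ← Finset.prod_mul_distrib]
  refine Finset.prod_congr rfl fun t _ => ?_
  rw [Finset.prod_range_succ', mul_comm]
  congr 1
  refine Finset.prod_congr rfl fun s _ => ?_
  omega

lemma det_coeff_rowPoly (m p : ℕ) :
    (Matrix.of fun i k : Fin p => (rowPoly m p k).coeff i).det = coeffDet m p := by
  induction p generalizing m with
  | zero => simp [coeffDet]
  | succ p ih =>
    set B : Matrix (Fin (p + 1)) (Fin (p + 1)) ℚ := Matrix.of fun i k =>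
      Fin.cases ((rowPoly m (p + 1) 0).coeff i)
        (fun k : Fin p => ((2 * m + k + 2 : ℕ) : ℚ) * (rowPoly (m + 1) p k).coeff i) k with hB
    rw [Matrix.det_eq_of_forall_col_eq_smul_add_pred (B := B) (fun _ => -2)]
    · rw [Matrix.det_succ_row B (Fin.last p), Finset.sum_eq_single_of_mem 0 (Finset.mem_univ _)]
      · have h1 : B (Fin.last p) 0 = (-1) ^ p := coeff_rowPoly_zero m p
        have h2 : B.submatrix (Fin.last p).succAbove (Fin.succAbove 0) =
            Matrix.of fun i k : Fin p => ((2 * m + k + 2 : ℕ) : ℚ) *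
              (Matrix.of fun i k : Fin p => (rowPoly (m + 1) p k).coeff i) i k := by
          ext i k
          simp [hB]
        rw [h1, h2, Matrix.det_mul_row, ih, coeffDet_succ]
        have h3 : ((-1 : ℚ) ^ p) * (-1) ^ p = 1 := by rw [← mul_pow]; simp
        simp only [Fin.val_last, Fin.val_zero, add_zero]
        rw [h3, one_mul, Nat.cast_mul, Nat.cast_prod]
      · intro k _ hk
        obtain ⟨k, rfl⟩ := Fin.exists_succ_eq.2 hk
        have : B (Fin.last p) k.succ = 0 := by
          simp only [hB, Matrix.of_apply, Fin.cases_succ, Fin.val_last]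
          rw [coeff_eq_zero_of_natDegree_lt (natDegree_rowPoly_lt _ k.2), mul_zero]
        rw [this, mul_zero, zero_mul]
    · intro i
      rfl
    · intro i k
      have := congrArg (fun f => coeff f i) (rowPoly_succ_add m p k k.2)
      simp only [coeff_add, coeff_C_mul] at this
      simp only [hB, Matrix.of_apply, Fin.cases_succ, Fin.val_succ, Fin.val_castSucc]
      linarith

lemma prod_factorial_eq_superFactorial (p : ℕ) :
    ∏ i : Fin (p + 1), (i : ℕ).factorial = p.superFactorial := by
  induction p with
  | zero => simp
  | succ p ih => rw [Fin.prod_univ_castSucc, Nat.superFactorial_succ, mul_comm]; simp [← ih]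

lemma det_eval_rowPoly (m p : ℕ) :
    (Matrix.of fun i k : Fin p => (rowPoly m p k).eval (i : ℚ)).det =
      (∏ i : Fin p, ((i : ℕ).factorial : ℚ)) * coeffDet m p := by
  have h : (Matrix.of fun i k : Fin p => (rowPoly m p k).eval (i : ℚ)) =
      Matrix.vandermonde (fun i : Fin p => (i : ℚ)) *
        Matrix.of fun i k : Fin p => (rowPoly m p k).coeff i := by
    ext i k
    rw [Matrix.of_apply, Matrix.mul_apply, eval_eq_sum_range' (natDegree_rowPoly_lt m k.2),
      ← Fin.sum_univ_eq_sum_range fun j => (rowPoly m p k).coeff j * (i : ℚ) ^ j]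
    simp only [Matrix.vandermonde_apply, Matrix.of_apply, mul_comm]
  rw [h, Matrix.det_mul, det_coeff_rowPoly]
  congr 1
  rcases p with _ | p
  · simp
  · rw [Matrix.det_vandermonde_id_eq_superFactorial, ← prod_factorial_eq_superFactorial,
      Nat.cast_prod]

lemma eval_rowPoly {m p i k : ℕ} (hi : i < p) (hk : k < p) :
    ((m + i).factorial : ℚ) * (rowPoly m p k).eval (i : ℚ) =
      (2 * i).factorial * (m + (p - 1 - i)).factorial *
        if k ≤ 2 * i then ((m + i).choose (2 * i - k) : ℚ) else 0 := by
  have h1 : (∏ l ∈ Finset.range k, (C 2 * X - C (l : ℚ))).eval (i : ℚ) =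
      ((2 * i).descFactorial k : ℚ) := by
    rw [eval_prod, Nat.descFactorial_eq_prod_range, Nat.cast_prod]
    by_cases h : k ≤ 2 * i
    · refine Finset.prod_congr rfl fun l hl => ?_
      rw [Finset.mem_range] at hl
      rw [Nat.cast_sub (by omega)]
      simp
    · rw [Finset.prod_eq_zero (Finset.mem_range.2 (not_le.1 h)) (by simp),
        Finset.prod_eq_zero (Finset.mem_range.2 (not_le.1 h)) (by simp)]
  rw [rowPoly, eval_mul, h1]
  split_ifs with h
  swap
  · rw [Nat.descFactorial_eq_zero_iff_lt.2 (by omega)]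
    simp
  by_cases h' : i ≤ m + k
  swap
  · rw [Nat.choose_eq_zero_of_lt (by omega), eval_prod,
      Finset.prod_eq_zero (i := i - m) (by rw [Finset.mem_Ico]; omega)]
    · simp
    · rw [show m + (i - m) = i by omega]
      simp
  have h2 : ((m + k - i).factorial : ℚ) *
      (∏ r ∈ Finset.Ico (k + 1) p, (C ((m + r : ℕ) : ℚ) - X)).eval (i : ℚ) =
        (m + (p - 1 - i)).factorial := by
    have h3 : (∏ r ∈ Finset.Ico (k + 1) p, (C ((m + r : ℕ) : ℚ) - X)).eval (i : ℚ) =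
        ((m + k - i + 1).ascFactorial (p - (k + 1)) : ℚ) := by
      rw [eval_prod, Finset.prod_Ico_eq_prod_range, Nat.ascFactorial_eq_prod_range, Nat.cast_prod]
      refine Finset.prod_congr rfl fun r _ => ?_
      rw [show m + k - i + 1 + r = m + (k + 1 + r) - i by omega, Nat.cast_sub (by omega)]
      simp
    rw [h3, ← Nat.cast_mul, Nat.factorial_mul_ascFactorial]
    congr 2
    omega
  have h4 := Nat.choose_mul_factorial_mul_factorial (n := m + i) (k := 2 * i - k) (by omega)
  rw [show m + i - (2 * i - k) = m + k - i by omega] at h4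
  have h5 := Nat.factorial_mul_descFactorial h
  rw [← h2, ← h4, ← h5]
  push_cast
  ring

lemma pairing_longest (m p : ℕ) :
    pairing m p (shiftedMonomial m (m + p) fun j => m + p - j) *
        ∏ i : Fin p, ((2 * i : ℕ).factorial : ℚ) =
      (∏ i : Fin p, ((i : ℕ).factorial : ℚ)) * coeffDet m p := by
  have hrev : (∏ i : Fin p, ((m + (p - 1 - i)).factorial : ℚ)) =
      ∏ i : Fin p, ((m + i : ℕ).factorial : ℚ) := by
    rw [← Equiv.prod_comp Fin.revPerm fun i : Fin p => ((m + i : ℕ).factorial : ℚ)]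
    refine Finset.prod_congr rfl fun i _ => ?_
    rw [Fin.revPerm_apply, Fin.val_rev, show p - (i + 1 : ℕ) = p - 1 - i by omega]
  have hdet : pairing m p (shiftedMonomial m (m + p) fun j => m + p - j) =
      (Matrix.of fun i k : Fin p =>
        if (k : ℕ) ≤ 2 * i then ((m + i).choose (2 * i - k) : ℚ) else 0).det := by
    rw [pairing_shiftedMonomial, ← Matrix.det_submatrix_equiv_self Fin.revPerm]
    congr 1
    ext i k
    simp only [Matrix.submatrix_apply, Matrix.of_apply, Fin.revPerm_apply, Fin.val_rev]
    rw [show m + p - (m + 1 + (p - (i + 1 : ℕ))) + m = m + i by omega]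
    by_cases h1 : (i : ℕ) ≤ m + k
    · rw [if_pos (by omega), show m + (p - (i + 1 : ℕ)) - (p - (k + 1)) = m + k - i by omega]
      split_ifs with h2
      · rw [← Nat.choose_symm (by omega), show m + (i : ℕ) - (m + k - i) = 2 * i - k by omega]
      · rw [Nat.choose_eq_zero_of_lt (by omega), Nat.cast_zero]
    · rw [if_neg (by omega), if_pos (by omega), Nat.choose_eq_zero_of_lt (by omega), Nat.cast_zero]
  have hscale := congrArg Matrix.det (Matrix.ext fun i k : Fin p =>
    show (Matrix.of fun i k : Fin p => ((m + i : ℕ).factorial : ℚ) *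
      (Matrix.of fun i k : Fin p => (rowPoly m p k).eval (i : ℚ)) i k) i k =
      (Matrix.of fun i k : Fin p => (((2 * i : ℕ).factorial : ℚ) * (m + (p - 1 - i)).factorial) *
        (Matrix.of fun i k : Fin p =>
          if (k : ℕ) ≤ 2 * i then ((m + i).choose (2 * i - k) : ℚ) else 0) i k) i k from
    eval_rowPoly i.2 k.2)
  rw [Matrix.det_mul_column, Matrix.det_mul_column, det_eval_rowPoly, ← hdet,
    Finset.prod_mul_distrib, hrev] at hscale
  have hne : (∏ i : Fin p, ((m + i : ℕ).factorial : ℚ)) ≠ 0 :=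
    Finset.prod_ne_zero_iff.2 fun i _ => Nat.cast_ne_zero.2 (Nat.factorial_ne_zero _)
  refine mul_left_cancel₀ hne ?_
  rw [hscale]
  ring

lemma F_succ (m p : ℕ) :
    F m (p + 1) = F m p * ∏ i ∈ Finset.range p, ((2 * m + i + p + 1 : ℕ) : ℝ) / (i + p + 1 : ℕ) := by
  unfold F
  have h : ∏ i ∈ Finset.range p, ((2 * m + i + p + 1 : ℕ) : ℝ) / (i + p + 1 : ℕ) =
      ∏ i ∈ Finset.Icc 1 p,
        (2 * (m : ℝ) + i + (p + 1 : ℕ) - 1) / ((i : ℝ) + (p + 1 : ℕ) - 1) := by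
    rw [← Finset.Ico_add_one_right_eq_Icc, Finset.prod_Ico_eq_prod_range, Nat.add_sub_cancel]
    refine Finset.prod_congr rfl fun i _ => ?_
    push_cast
    congr 1 <;> ring
  rw [h, ← Finset.prod_mul_distrib, Finset.prod_Icc_succ_top (by omega), Finset.Ioc_self,
    Finset.prod_empty, mul_one]
  refine Finset.prod_congr rfl fun i hi => ?_
  rw [Finset.prod_Ioc_succ_top (Finset.mem_Icc.1 hi).2]

lemma F_mul_prod_factorial (m p : ℕ) :
    F m p * ∏ i : Fin p, ((2 * i : ℕ).factorial : ℝ) =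
      (∏ i : Fin p, ((i : ℕ).factorial : ℝ)) * coeffDet m p := by
  induction p with
  | zero => simp [F, coeffDet]
  | succ p ih =>
    have h1 : (p.factorial : ℝ) * ∏ i ∈ Finset.range p, ((i + p + 1 : ℕ) : ℝ) =
        (2 * p).factorial := by
      rw [two_mul, ← Nat.factorial_mul_ascFactorial, Nat.ascFactorial_eq_prod_range]
      push_cast
      congr 1
      refine Finset.prod_congr rfl fun i _ => ?_
      ring
    have h2 : (∏ i ∈ Finset.range p, ((i + p + 1 : ℕ) : ℝ)) ≠ 0 :=
      Finset.prod_ne_zero_iff.2 fun i _ => Nat.cast_ne_zero.2 (Nat.succ_ne_zero _)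
    rw [F_succ, Fin.prod_univ_castSucc, Fin.prod_univ_castSucc, coeffDet,
      Finset.prod_range_succ, ← coeffDet, Nat.cast_mul, Finset.prod_div_distrib]
    simp only [Fin.val_castSucc, Fin.val_last]
    rw [← h1, Nat.cast_prod]
    field_simp
    linear_combination ih

lemma pairing_longest_eq_F (m p : ℕ) :
    ((pairing m p (shiftedMonomial m (m + p) fun j => m + p - j) : ℚ) : ℝ) = F m p := by
  have h : (∏ i : Fin p, ((2 * i : ℕ).factorial : ℝ)) ≠ 0 :=
    Finset.prod_ne_zero_iff.2 fun i _ => Nat.cast_ne_zero.2 (Nat.factorial_ne_zero _)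
  refine mul_right_cancel₀ h ?_
  rw [F_mul_prod_factorial]
  exact_mod_cast pairing_longest m p

end Evaluation

/-! ### Layered permutations -/

section Layered

lemma prod_map_swap_apply (s c r x : ℕ) (hr : r ≤ c / 2) :
    ((List.range r).map fun i => Equiv.swap (s + i + 1) (s + c - i)).prod x =
      if s < x ∧ x ≤ s + r ∨ s + c - r < x ∧ x ≤ s + c then 2 * s + c + 1 - x else x := by
  induction r generalizing x with
  | zero =>
    rw [if_neg (by omega)]
    rfl
  | succ r ih =>
    rw [List.range_succ, List.map_append, List.prod_append, Equiv.Perm.mul_apply,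
      ih _ (by omega), List.map_singleton, List.prod_singleton, Equiv.swap_apply_def]
    split_ifs <;> omega

lemma blockRev_apply (s c x : ℕ) :
    blockRev s c x = if x ∈ Finset.Ioc s (s + c) then 2 * s + c + 1 - x else x := by
  rw [blockRev, prod_map_swap_apply s c _ x le_rfl]
  simp only [Finset.mem_Ioc]
  split_ifs <;> omega

lemma fixesOff_blockRev (s c : ℕ) : FixesOff (Finset.Ioc s (s + c)) (blockRev s c) := by
  intro x hx
  rw [blockRev_apply, if_neg hx]

lemma strictAntiOn_blockRev (s c : ℕ) :
    StrictAntiOn (blockRev s c) (Finset.Ioc s (s + c)) := by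
  intro x hx y hy hxy
  rw [Finset.mem_coe] at hx hy
  rw [blockRev_apply, blockRev_apply, if_pos hx, if_pos hy]
  rw [Finset.mem_Ioc] at hx hy
  omega

lemma layeredPerm_append_singleton (l : List ℕ) (b : ℕ) :
    layeredPerm (l ++ [b]) = layeredPerm l * blockRev l.sum b := by
  unfold layeredPerm
  rw [List.length_append, List.length_singleton, List.range_succ, List.map_append,
    List.prod_append, List.map_singleton, List.prod_singleton, List.take_left,
    List.getD_append_right _ _ _ _ le_rfl, Nat.sub_self]
  congr 2
  refine List.map_congr_left fun j hj => ?_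
  rw [List.mem_range] at hj
  rw [List.take_append_of_le_length hj.le, List.getD_append _ _ _ _ hj]

lemma fixesOff_layeredPerm (l : List ℕ) : FixesOff (Finset.Ioc 0 l.sum) (layeredPerm l) := by
  induction l using List.reverseRecOn with
  | nil => exact fun _ _ => rfl
  | append_singleton l b ih =>
    rw [layeredPerm_append_singleton, List.sum_append, List.sum_singleton]
    exact ih.mul_Ioc (fixesOff_blockRev _ _)

end Layered

/-- For positive integers `b_1, …, b_k` (`k ≥ 1`, blocks of the layered permutation
listed left to right as `l ++ [b₁]` with `l = [b_k, …, b_2]`, possibly empty):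
`Υ_{w(b_k,…,b_2,b_1)} = Υ_{w(b_k,…,b_2)} · F(|b| − b_1, b_1)`, where for `k = 1`
the first factor `Υ_{w()} = Υ_{id} = 1`. -/
theorem upsilon_layered_recursion (l : List ℕ) (b₁ : ℕ) (hb₁ : 0 < b₁)
    (hl : ∀ c ∈ l, 0 < c) :
    ((Upsilon (l.sum + b₁) (layeredPerm (l ++ [b₁])) : ℚ) : ℝ)
      = ((Upsilon l.sum (layeredPerm l) : ℚ) : ℝ) * F l.sum b₁ := by
  have hb := fixesOff_blockRev l.sum b₁
  have ha := strictAntiOn_blockRev l.sum b₁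
  have h1 : pairing l.sum b₁ (schubert l.sum (l.sum + b₁) 1) = 1 := by
    rw [schubert_one hb ha (Nat.le_add_right _ _), pairing_one]
  rw [layeredPerm_append_singleton, upsilon_mul h1 (fixesOff_layeredPerm l) hb, Rat.cast_mul,
    schubert_longest ha, pairing_longest_eq_F]
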